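/- arXiv:1601.01103 — 6 statements merged into one kernel-verified Lean document; each statement's English description precedes it below -/
import Mathlib

section
/- Let R be a commutative ring. Then R is self FP-injective (i.e., R is FP-injective as a module over itself) if and only if every flat R-module is almost FP-injective. -/
open CategoryTheory

universe u

/-- A chain ring: the lattice of ideals is totally ordered by inclusion. -/
def IsChainRing (R : Type u) [CommRing R] : Prop :=
  ∀ I J : Ideal R, I ≤ J ∨ J ≤ I

/-- The set of zero-divisors of `R`. -/
def zeroDivisorsSet (R : Type u) [CommRing R] : Set R :=
  {r : R | ∃ s : R, s ≠ 0 ∧ r * s = 0}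

/-- An `R`-module `E` is FP-injective if `Ext¹_R(F, E) = 0` for every finitely
presented `R`-module `F`. -/
def IsFPInjective (R : Type u) [CommRing R] (E : Type u) [AddCommGroup E] [Module R E] : Prop :=
  ∀ F : ModuleCat.{u} R, Module.FinitePresentation R F →
    Limits.IsZero (((Ext R (ModuleCat.{u} R) 1).obj (Opposite.op F)).obj (ModuleCat.of R E))

/-- A submodule `D ≤ E` is pure if `0 → D ⊗ N → E ⊗ N` is exact for every module `N`,
i.e. the sequence `0 → D → E → E/D → 0` remains exact after tensoring with any module. -/
def IsPureSubmodule {R : Type u} [CommRing R] {E : Type u} [AddCommGroup E] [Module R E]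
    (D : Submodule R E) : Prop :=
  ∀ (N : Type u) [AddCommGroup N] [Module R N],
    Function.Injective (LinearMap.rTensor N D.subtype)

/-- An `R`-module `G` is almost FP-injective if `G ≅ E/D` for some FP-injective module `E`
and pure submodule `D` of `E`. -/
def IsAlmostFPInjective (R : Type u) [CommRing R] (G : Type u) [AddCommGroup G]
    [Module R G] : Prop :=
  ∃ (E : Type u) (_ : AddCommGroup E) (_ : Module R E) (D : Submodule R E),
    IsFPInjective R E ∧ IsPureSubmodule D ∧ Nonempty ((E ⧸ D) ≃ₗ[R] G)

/-- The weak dimension of a module, as an element of `ℕ∞`: the least `n` such that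
`Tor_{n+1}(M, N) = 0` for all modules `N` (and `⊤ = ∞` if there is no such `n`). -/
noncomputable def weakDim (R : Type u) [CommRing R] (M : Type u) [AddCommGroup M]
    [Module R M] : ℕ∞ :=
  sInf {n : ℕ∞ | ∃ k : ℕ, n = k ∧ ∀ N : ModuleCat.{u} R,
    Limits.IsZero (((Tor (ModuleCat.{u} R) (k + 1)).obj (ModuleCat.of R M)).obj N)}

/-- The projective dimension of a module, as an element of `ℕ∞`: the least `n` such that
`Ext^{n+1}(M, N) = 0` for all modules `N` (and `⊤ = ∞` if there is no such `n`). -/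
noncomputable def projDim (R : Type u) [CommRing R] (M : Type u) [AddCommGroup M]
    [Module R M] : ℕ∞ :=
  sInf {n : ℕ∞ | ∃ k : ℕ, n = k ∧ ∀ N : ModuleCat.{u} R,
    Limits.IsZero (((Ext R (ModuleCat.{u} R) (k + 1)).obj
      (Opposite.op (ModuleCat.of R M))).obj N)}

/-- An IF-ring: every injective module is flat. -/
def IsIFRing (R : Type u) [CommRing R] : Prop :=
  ∀ (M : Type u) [AddCommGroup M] [Module R M], Module.Injective R M → Module.Flat R M

/-- A semicoherent ring: `Hom_R(E, F)` embeds into a flat module for every pair of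
injective modules `E`, `F`. -/
def IsSemicoherent (R : Type u) [CommRing R] : Prop :=
  ∀ (E F : Type u) [AddCommGroup E] [Module R E] [AddCommGroup F] [Module R F],
    Module.Injective R E → Module.Injective R F →
      ∃ (W : Type u) (_ : AddCommGroup W) (_ : Module R W),
        Module.Flat R W ∧ ∃ f : (E →ₗ[R] F) →ₗ[R] W, Function.Injective f

/-- A coherent ring: every finitely generated ideal is finitely presented. -/
def IsCoherentRing (R : Type u) [CommRing R] : Prop :=
  ∀ I : Ideal R, I.FG → Module.FinitePresentation R I

/-- `i : M →ₗ[R] E` exhibits `E` as an injective hull of `M`: `E` is injective and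
`i` is an essential embedding. -/
def IsInjectiveHull (R : Type u) [CommRing R] (M E : Type u) [AddCommGroup M] [Module R M]
    [AddCommGroup E] [Module R E] (i : M →ₗ[R] E) : Prop :=
  Module.Injective R E ∧ Function.Injective i ∧
    ∀ K : Submodule R E, K ≠ ⊥ → K ⊓ LinearMap.range i ≠ ⊥

/-- The bottom prime ideal `M_♯` (as a set): elements killing some nonzero element of `M`. -/
def bottomSet (R : Type u) [CommRing R] (M : Type u) [AddCommGroup M] [Module R M] : Set R :=
  {s : R | ∃ x : M, x ≠ 0 ∧ s • x = 0}

/-- The top prime ideal `M^♯` (as a set): elements `s` with `sM ⊊ M`. -/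
def topSet (R : Type u) [CommRing R] (M : Type u) [AddCommGroup M] [Module R M] : Set R :=
  {s : R | ¬ Function.Surjective fun x : M => s • x}

/-- Extendability to `P` of all maps out of `ker p` depends only on the target of the projective
presentation `p`. -/
theorem exists_extend_ker_of_projective {R : Type*} [Ring R] {F P Q E : Type*}
    [AddCommGroup F] [Module R F] [AddCommGroup P] [Module R P] [AddCommGroup Q] [Module R Q]
    [AddCommGroup E] [Module R E] [Module.Projective R P] [Module.Projective R Q]
    {p : P →ₗ[R] F} {q : Q →ₗ[R] F} (hp : Function.Surjective p) (hq : Function.Surjective q)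
    (H : ∀ h : LinearMap.ker p →ₗ[R] E, ∃ g : P →ₗ[R] E, g ∘ₗ (LinearMap.ker p).subtype = h)
    (h : LinearMap.ker q →ₗ[R] E) :
    ∃ g : Q →ₗ[R] E, g ∘ₗ (LinearMap.ker q).subtype = h := by
  obtain ⟨a, ha⟩ := Module.projective_lifting_property q p hq
  obtain ⟨c, hc⟩ := Module.projective_lifting_property p q hp
  have ha' (x) : q (a x) = p x := LinearMap.congr_fun ha x
  have hc' (x) : p (c x) = q x := LinearMap.congr_fun hc x
  let b : LinearMap.ker p →ₗ[R] LinearMap.ker q :=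
    a.restrict fun x hx => by simpa [ha'] using hx
  let d : Q →ₗ[R] LinearMap.ker q :=
    (a ∘ₗ c - LinearMap.id).codRestrict _ fun x => by simp [ha', hc']
  obtain ⟨g, hg⟩ := H (h ∘ₗ b)
  refine ⟨g ∘ₗ c - h ∘ₗ d, LinearMap.ext fun x => ?_⟩
  have hx : p (c x) = 0 := by rw [hc']; exact x.2
  have h1 : g (c x) = h (b ⟨c x, hx⟩) := LinearMap.congr_fun hg ⟨c x, hx⟩
  have h2 : b ⟨c x, hx⟩ - d x = x := by
    ext; simp [b, d]
  simp only [LinearMap.comp_apply, LinearMap.sub_apply, Submodule.subtype_apply]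
  rw [h1, ← map_sub, h2]

/-- `Ext¹(F, E)` vanishes iff all maps from the first syzygy of a projective resolution extend. -/
theorem isZero_ext_one_iff_of_resolution {R : Type u} [CommRing R] {F : ModuleCat.{u} R}
    (E : ModuleCat.{u} R) (P : ProjectiveResolution F) :
    Limits.IsZero (((Ext R (ModuleCat.{u} R) 1).obj (Opposite.op F)).obj E) ↔
      ∀ h : LinearMap.ker (P.π.f 0).hom →ₗ[R] E, ∃ g : P.complex.X 0 →ₗ[R] E,
        g ∘ₗ (LinearMap.ker (P.π.f 0).hom).subtype = h := by
  have hex : Function.Exact (P.complex.d 1 0).hom (P.π.f 0).hom :=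
    (ShortComplex.ShortExact.moduleCat_exact_iff_function_exact _).1 P.exact₀
  have hdd : (P.complex.d 1 0).hom ∘ₗ (P.complex.d 2 1).hom = 0 := by
    rw [← ModuleCat.hom_comp, P.complex.d_comp_d]; rfl
  have hex' : Function.Exact (P.complex.d 2 1).hom (P.complex.d 1 0).hom :=
    (ShortComplex.ShortExact.moduleCat_exact_iff_function_exact _).1 (P.exact_succ 0)
  rw [(P.isoExt 1 E).isZero_iff, ← HomologicalComplex.exactAt_iff_isZero_homology,
    HomologicalComplex.exactAt_iff' _ 0 1 2 (by simp) (by simp), ShortComplex.moduleCat_exact_iff]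
  let d : P.complex.X 1 →ₗ[R] LinearMap.ker (P.π.f 0).hom :=
    (P.complex.d 1 0).hom.codRestrict _ hex.apply_apply_eq_zero
  have hd : Function.Surjective d := fun x => by
    obtain ⟨y, hy⟩ := (hex x).1 x.2
    exact ⟨y, Subtype.ext hy⟩
  constructor
  · intro H h
    obtain ⟨g, hg⟩ := H (ModuleCat.ofHom (h ∘ₗ d)) (by
      change P.complex.d 2 1 ≫ ModuleCat.ofHom (h ∘ₗ d) = 0
      ext y
      have hy : d ((P.complex.d 2 1).hom y) = 0 := Subtype.ext (LinearMap.congr_fun hdd y)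
      exact (congrArg h hy).trans (map_zero h))
    refine ⟨ModuleCat.Hom.hom g, LinearMap.ext fun x => ?_⟩
    obtain ⟨y, rfl⟩ := hd x
    exact LinearMap.congr_fun (congrArg ModuleCat.Hom.hom hg) y
  · intro H f hf
    have hf' : P.complex.d 2 1 ≫ f = 0 := hf
    obtain ⟨h, hh⟩ : ∃ h : LinearMap.ker (P.π.f 0).hom →ₗ[R] E, h ∘ₗ d = f.hom := by
      have hk : LinearMap.ker d ≤ LinearMap.ker f.hom := fun x hx => by
        obtain ⟨y, rfl⟩ := (hex' x).1 (congrArg Subtype.val hx)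
        exact LinearMap.congr_fun (congrArg ModuleCat.Hom.hom hf') y
      refine ⟨(LinearMap.ker d).liftQ f.hom hk ∘ₗ (d.quotKerEquivOfSurjective hd).symm,
        LinearMap.ext fun x => ?_⟩
      have hx : (d.quotKerEquivOfSurjective hd).symm (d x) = (LinearMap.ker d).mkQ x :=
        (LinearEquiv.symm_apply_eq _).2 rfl
      exact (congrArg _ hx).trans ((LinearMap.ker d).liftQ_apply (h := hk) _ _)
    obtain ⟨g, hg⟩ := H h
    refine ⟨ModuleCat.ofHom g, ?_⟩
    change P.complex.d 1 0 ≫ ModuleCat.ofHom g = f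
    ext y
    rw [← hh, ← hg]
    rfl

/-- `Ext¹(F, E)` vanishes iff all maps from the kernel of a projective presentation of `F` to `E`
extend. -/
theorem isZero_ext_one_iff {R : Type u} [CommRing R] {F E Q : Type u} [AddCommGroup F] [Module R F]
    [AddCommGroup E] [Module R E] [AddCommGroup Q] [Module R Q] [Module.Projective R Q]
    {q : Q →ₗ[R] F} (hq : Function.Surjective q) :
    Limits.IsZero (((Ext R (ModuleCat.{u} R) 1).obj (Opposite.op (ModuleCat.of R F))).obj
      (ModuleCat.of R E)) ↔
      ∀ h : LinearMap.ker q →ₗ[R] E, ∃ g : Q →ₗ[R] E,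
        g ∘ₗ (LinearMap.ker q).subtype = h := by
  let P := projectiveResolution (ModuleCat.of R F)
  rw [isZero_ext_one_iff_of_resolution _ P]
  have : Module.Projective R (P.complex.X 0) :=
    (IsProjective.iff_projective (R := R) (P.complex.X 0)).2 (P.projective 0)
  have hp : Function.Surjective (P.π.f 0).hom := (ModuleCat.epi_iff_surjective _).1 inferInstance
  exact ⟨fun H => exists_extend_ker_of_projective hp hq H,
    fun H => exists_extend_ker_of_projective hq hp H⟩

/-- FP-injectivity passes to retracts. -/
theorem IsFPInjective.of_retract {R : Type u} [CommRing R] {E G : Type u} [AddCommGroup E]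
    [Module R E] [AddCommGroup G] [Module R G] (hE : IsFPInjective R E)
    (i : G →ₗ[R] E) (r : E →ₗ[R] G) (h : r ∘ₗ i = LinearMap.id) : IsFPInjective R G := by
  intro F hF
  let T := (Ext R (ModuleCat.{u} R) 1).obj (Opposite.op F)
  have hid : T.map (ModuleCat.ofHom i) ≫ T.map (ModuleCat.ofHom r) = 𝟙 _ := by
    rw [← T.map_comp, ← ModuleCat.ofHom_comp, h, ModuleCat.ofHom_id, T.map_id]
  rw [Limits.IsZero.iff_id_eq_zero]
  change 𝟙 (T.obj _) = 0
  rw [← hid, (hE F hF).eq_of_tgt (T.map (ModuleCat.ofHom i)) 0, Limits.zero_comp]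

/-- A map from a finitely generated module to a finitely supported power extends if all its
coordinates do. -/
theorem exists_extend_finsupp {R : Type*} [Ring R] {K Q E ι : Type*}
    [AddCommGroup K] [Module R K] [AddCommGroup Q] [Module R Q]
    [AddCommGroup E] [Module R E] [Module.Finite R K] (j : K →ₗ[R] Q)
    (H : ∀ h : K →ₗ[R] E, ∃ g : Q →ₗ[R] E, g ∘ₗ j = h) (h : K →ₗ[R] ι →₀ E) :
    ∃ g : Q →ₗ[R] ι →₀ E, g ∘ₗ j = h := by
  classical
  obtain ⟨T, hT⟩ := Module.Finite.fg_top (R := R) (M := K)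
  let S : Finset ι := T.biUnion fun t => (h t).support
  have hS (x : K) : h x ∈ Finsupp.supported E R (S : Set ι) := by
    have : Submodule.span R (T : Set K) ≤ (Finsupp.supported E R (S : Set ι)).comap h := by
      rw [Submodule.span_le]
      intro t ht
      simp only [SetLike.mem_coe, Submodule.mem_comap, Finsupp.mem_supported,
        Finset.coe_subset]
      exact Finset.subset_biUnion_of_mem (fun t => (h t).support) ht
    exact this (hT ▸ Submodule.mem_top)
  choose g hg using fun i => H (Finsupp.lapply i ∘ₗ h)
  refine ⟨∑ i ∈ S, Finsupp.lsingle i ∘ₗ g i, LinearMap.ext fun x => ?_⟩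
  have hg' (i) : g i (j x) = h x i := LinearMap.congr_fun (hg i) x
  simp only [LinearMap.comp_apply, LinearMap.sum_apply, Finsupp.lsingle_apply, hg']
  exact (Finsupp.sum_of_support_subset _ (by simpa [Finsupp.mem_supported] using hS x) _
    (by simp)).symm.trans (Finsupp.sum_single _)

/-- FP-injectivity passes to direct sums of copies. -/
theorem IsFPInjective.finsupp {R : Type u} [CommRing R] {E : Type u} [AddCommGroup E]
    [Module R E] (hE : IsFPInjective R E) (ι : Type u) : IsFPInjective R (ι →₀ E) := by
  intro F hF
  obtain ⟨n, f, hf⟩ := Module.Finite.exists_fin' R F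
  have : Module.Finite R (LinearMap.ker f) :=
    .of_fg (Module.FinitePresentation.fg_ker f hf)
  exact (isZero_ext_one_iff hf).2
    (exists_extend_finsupp _ ((isZero_ext_one_iff hf).1 (hE F hF)))

/-- A submodule of a flat module with flat quotient is pure. -/
theorem IsPureSubmodule.of_flat_quotient {R : Type u} [CommRing R] {E : Type u} [AddCommGroup E]
    [Module R E] [Module.Flat R E] (D : Submodule R E) [Module.Flat R (E ⧸ D)] :
    IsPureSubmodule D := by
  intro N _ _
  obtain ⟨P, _, _, _, q, hq⟩ : ∃ (P : Type u) (_ : AddCommGroup P) (_ : Module R P)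
      (_ : Module.Flat R P) (q : P →ₗ[R] N), Function.Surjective q :=
    ⟨N →₀ R, inferInstance, inferInstance, inferInstance, _,
      Finsupp.linearCombination_id_surjective R N⟩
  let l := (LinearMap.ker q).subtype
  have hlq : Function.Exact l q := LinearMap.exact_subtype_ker_map q
  have hD : Function.Exact D.subtype D.mkQ := LinearMap.exact_subtype_mkQ D
  rw [injective_iff_map_eq_zero]
  intro x hx
  obtain ⟨y, rfl⟩ := LinearMap.lTensor_surjective D hq x
  have comm (A B : Type u) [AddCommGroup A] [Module R A] [AddCommGroup B] [Module R B]
      (s : A →ₗ[R] B) (C C' : Type u) [AddCommGroup C] [Module R C] [AddCommGroup C']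
      [Module R C'] (t : C →ₗ[R] C') (z : TensorProduct R A C) :
      s.rTensor C' (t.lTensor A z) = t.lTensor B (s.rTensor C z) := by
    rw [← LinearMap.comp_apply, ← LinearMap.comp_apply, LinearMap.rTensor_comp_lTensor,
      LinearMap.lTensor_comp_rTensor]
  rw [comm] at hx
  obtain ⟨z, hz⟩ := (lTensor_exact E hlq hq _).1 hx
  have hz0 : D.mkQ.rTensor _ z = 0 := by
    apply Module.Flat.lTensor_preserves_injective_linearMap (M := E ⧸ D) l
      (Submodule.subtype_injective _)
    rw [← comm, hz, map_zero, ← LinearMap.comp_apply, ← LinearMap.rTensor_comp,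
      hD.linearMap_comp_eq_zero, LinearMap.rTensor_zero, LinearMap.zero_apply]
  obtain ⟨w, rfl⟩ := (rTensor_exact _ hD D.mkQ_surjective z).1 hz0
  have : y = l.lTensor D w := by
    apply Module.Flat.rTensor_preserves_injective_linearMap (M := P) D.subtype
      D.subtype_injective
    rw [comm, hz]
  rw [this, ← LinearMap.comp_apply, ← LinearMap.lTensor_comp, hlq.linearMap_comp_eq_zero,
    LinearMap.lTensor_zero, LinearMap.zero_apply]

/-- A commutative ring `R` is self FP-injective if and only if
every flat `R`-module is almost FP-injective. -/
theorem selfFPInjective_iff_flat_isAlmostFPInjective (R : Type u) [CommRing R] :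
    IsFPInjective R R ↔
      ∀ (M : Type u) [AddCommGroup M] [Module R M],
        Module.Flat R M → IsAlmostFPInjective R M := by
  constructor
  · intro hR M _ _ hM
    let q : (M →₀ R) →ₗ[R] M := Finsupp.linearCombination R id
    let e := q.quotKerEquivOfSurjective (Finsupp.linearCombination_id_surjective R M)
    have := Module.Flat.of_linearEquiv e
    exact ⟨M →₀ R, inferInstance, inferInstance, LinearMap.ker q, hR.finsupp M,
      IsPureSubmodule.of_flat_quotient _, ⟨e⟩⟩
  · intro H
    obtain ⟨E, _, _, D, hE, -, ⟨e⟩⟩ := H R inferInstance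
    obtain ⟨i, hi⟩ := Module.projective_lifting_property (e.toLinearMap ∘ₗ D.mkQ) LinearMap.id
      (e.surjective.comp D.mkQ_surjective)
    exact hE.of_retract i _ hi
end

section
/- Let R be a commutative ring and let 0 → L → M → N → 0 be a pure exact sequence of R-modules. Then w.d.(M) = max(w.d.(L), w.d.(N)). -/
open CategoryTheory

universe u

namespace CategoryTheory

open Limits

/-- Discarding the degree `0` term of a projective resolution `P` gives a projective resolution
of the cokernel of `P₂ ⟶ P₁`. -/
noncomputable def ProjectiveResolution.truncate {C : Type*} [Category* C] [Abelian C] {X : C}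
    (P : ProjectiveResolution X) :
    ProjectiveResolution (cokernel (P.complex.d 2 1)) where
  complex := ChainComplex.truncate.obj P.complex
  projective n := P.projective (n + 1)
  π := (ChainComplex.toSingle₀Equiv _ _).symm
    ⟨cokernel.π (P.complex.d 2 1), cokernel.condition (P.complex.d 2 1)⟩
  quasiIso := by
    constructor
    intro n
    cases n with
    | zero =>
      rw [ChainComplex.quasiIsoAt₀_iff, ShortComplex.quasiIso_iff_of_zeros' _
        (HomologicalComplex.shape _ _ _ (by simp)) rfl rfl]
      have hπ : ((ChainComplex.toSingle₀Equiv (ChainComplex.truncate.obj P.complex) _).symm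
          ⟨cokernel.π (P.complex.d 2 1), cokernel.condition (P.complex.d 2 1)⟩).f 0 =
          cokernel.π (P.complex.d 2 1) :=
        ChainComplex.toSingle₀Equiv_symm_apply_f_zero _ _
      have aux (φ : P.complex.X 1 ⟶ cokernel (P.complex.d 2 1)) (w : P.complex.d 2 1 ≫ φ = 0)
          (hφ : φ = cokernel.π (P.complex.d 2 1)) : (ShortComplex.mk _ φ w).Exact ∧ Epi φ := by
        subst hφ
        exact ⟨ShortComplex.exact_cokernel _, inferInstance⟩
      exact aux _ _ hπ
    | succ n =>
      rw [quasiIsoAt_iff_exactAt' _ _ (ChainComplex.exactAt_succ_single_obj _ _),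
        HomologicalComplex.exactAt_iff' _ (n + 2) (n + 1) n (by simp) (by simp)]
      exact P.exact_succ (n + 1)

/-- The left-derived functors of `F` at `X` vanish in positive degree `n + 1` exactly when the
image under `F` of a projective resolution is exact there. -/
lemma ProjectiveResolution.isZero_leftDerived_succ_iff {C D : Type*} [Category* C] [Category* D]
    [Abelian C] [HasProjectiveResolutions C] [Abelian D] (F : C ⥤ D) [F.Additive] {X : C}
    (P : ProjectiveResolution X) (n : ℕ) :
    IsZero ((F.leftDerived (n + 1)).obj X) ↔
      ((P.complex.sc' (n + 2) (n + 1) n).map F).Exact := by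
  rw [(P.isoLeftDerivedObj F (n + 1)).isZero_iff]
  change IsZero (((F.mapHomologicalComplex _).obj P.complex).homology (n + 1)) ↔ _
  rw [← HomologicalComplex.exactAt_iff_isZero_homology,
    HomologicalComplex.exactAt_iff' _ (n + 2) (n + 1) n (by simp) (by simp)]
  rfl

/-- Dimension shifting: if a positive left-derived functor vanishes, so does the next one. -/
lemma Functor.isZero_leftDerived_succ_of_forall {C D : Type*} [Category* C] [Category* D]
    [Abelian C] [HasProjectiveResolutions C] [Abelian D] (F : C ⥤ D) [F.Additive] {n : ℕ}
    (h : ∀ X, IsZero ((F.leftDerived (n + 1)).obj X)) (X : C) :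
    IsZero ((F.leftDerived (n + 2)).obj X) := by
  let P := projectiveResolution X
  rw [P.isZero_leftDerived_succ_iff F]
  exact (P.truncate.isZero_leftDerived_succ_iff F n).1 (h _)

end CategoryTheory

section PureExact

variable {R L M N : Type*} [CommRing R] [AddCommGroup L] [Module R L] [AddCommGroup M]
  [Module R M] [AddCommGroup N] [Module R N] {f : L →ₗ[R] M} {g : M →ₗ[R] N}
  {A B C : Type*} [AddCommGroup A] [Module R A] [AddCommGroup B] [Module R B]
  [AddCommGroup C] [Module R C]

open LinearMap

lemma LinearMap.rTensor_lTensor_apply (h : A →ₗ[R] B) (x : TensorProduct R L A) :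
    f.rTensor B (h.lTensor L x) = h.lTensor M (f.rTensor A x) := by
  rw [← LinearMap.comp_apply, ← LinearMap.comp_apply, rTensor_comp_lTensor, lTensor_comp_rTensor]

lemma LinearMap.lTensor_lTensor_eq_zero {a : A →ₗ[R] B} {b : B →ₗ[R] C} (hab : b ∘ₗ a = 0)
    (x : TensorProduct R M A) : b.lTensor M (a.lTensor M x) = 0 := by
  rw [← LinearMap.comp_apply, ← lTensor_comp, hab, lTensor_zero, zero_apply]

/-- If `f : L → M` stays injective after tensoring with the cokernel of `h : A → B`, then an
element of `L ⊗ B` lies in the image of `L ⊗ A` as soon as it does so in `M ⊗ B`. -/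
lemma LinearMap.mem_range_lTensor_of_rTensor_mem (h : A →ₗ[R] B)
    (hf : Function.Injective (f.rTensor (B ⧸ range h))) {x : TensorProduct R L B}
    (hx : f.rTensor B x ∈ range (h.lTensor M)) : x ∈ range (h.lTensor L) := by
  have hex : Function.Exact h (range h).mkQ := exact_map_mkQ_range h
  have hsurj := (range h).mkQ_surjective
  rw [← exact_iff.1 (lTensor_exact L hex hsurj), mem_ker]
  apply hf
  rw [rTensor_lTensor_apply, map_zero]
  exact (lTensor_exact M hex hsurj _).2 hx

/-- Tensoring a complex `A → B → C` with a pure exact sequence `0 → L → M → N → 0`: the result is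
exact for `M` if and only if it is so for `L` and `N`. -/
lemma exact_lTensor_iff_of_pure_exact (hg : Function.Surjective g) (hfg : Function.Exact f g)
    {a : A →ₗ[R] B} {b : B →ₗ[R] C} (hab : b ∘ₗ a = 0)
    (hB : Function.Injective (f.rTensor (B ⧸ range a)))
    (hC : Function.Injective (f.rTensor (C ⧸ range b)))
    (hC' : Function.Injective (f.rTensor C)) :
    Function.Exact (a.lTensor M) (b.lTensor M) ↔
      Function.Exact (a.lTensor L) (b.lTensor L) ∧
        Function.Exact (a.lTensor N) (b.lTensor N) := by
  have hfgB := rTensor_exact B hfg hg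
  have hfgC := rTensor_exact C hfg hg
  constructor
  · refine fun h ↦ ⟨fun x ↦ ⟨fun hx ↦ ?_, ?_⟩, fun x ↦ ⟨fun hx ↦ ?_, ?_⟩⟩
    · refine mem_range_lTensor_of_rTensor_mem a hB ((h _).1 ?_)
      rw [← rTensor_lTensor_apply, hx, map_zero]
    · rintro ⟨y, rfl⟩
      exact lTensor_lTensor_eq_zero hab y
    · obtain ⟨y, rfl⟩ := rTensor_surjective B hg x
      rw [← rTensor_lTensor_apply] at hx
      obtain ⟨w, hw⟩ := (hfgC _).1 hx
      obtain ⟨v, rfl⟩ := mem_range_lTensor_of_rTensor_mem b hC (x := w) ⟨y, hw.symm⟩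
      obtain ⟨u, hu⟩ := (h (y - f.rTensor B v)).1 (by
        rw [map_sub, ← hw, rTensor_lTensor_apply, sub_self])
      refine ⟨g.rTensor A u, ?_⟩
      rw [← rTensor_lTensor_apply, hu, map_sub, (hfgB _).2 ⟨v, rfl⟩, sub_zero]
    · rintro ⟨y, rfl⟩
      exact lTensor_lTensor_eq_zero hab y
  · rintro ⟨hL, hN⟩ y
    refine ⟨fun hy ↦ ?_, ?_⟩
    · obtain ⟨t, ht⟩ := (hN (g.rTensor B y)).1 (by rw [← rTensor_lTensor_apply, hy, map_zero])
      obtain ⟨s, rfl⟩ := rTensor_surjective A hg t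
      obtain ⟨v, hv⟩ := (hfgB (y - a.lTensor M s)).1 (by
        rw [map_sub, rTensor_lTensor_apply, ht, sub_self])
      obtain ⟨q, rfl⟩ := (hL v).1 (hC' (by
        rw [rTensor_lTensor_apply, hv, map_sub, hy, lTensor_lTensor_eq_zero hab, sub_zero,
          map_zero]))
      refine ⟨s + f.rTensor A q, ?_⟩
      rw [map_add, ← rTensor_lTensor_apply, hv, add_sub_cancel]
    · rintro ⟨y, rfl⟩
      exact lTensor_lTensor_eq_zero hab y

end PureExact

lemma ENat.sInf_coe_and_eq_max {p q : ℕ → Prop} (hp : ∀ n, p n → p (n + 1))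
    (hq : ∀ n, q n → q (n + 1)) :
    sInf {n : ℕ∞ | ∃ k : ℕ, n = k ∧ p k ∧ q k} =
      max (sInf {n : ℕ∞ | ∃ k : ℕ, n = k ∧ p k}) (sInf {n : ℕ∞ | ∃ k : ℕ, n = k ∧ q k}) := by
  apply le_antisymm
  · rcases Set.eq_empty_or_nonempty {n : ℕ∞ | ∃ k : ℕ, n = k ∧ p k} with h | h
    · rw [h, sInf_empty, max_eq_left le_top]
      exact le_top
    rcases Set.eq_empty_or_nonempty {n : ℕ∞ | ∃ k : ℕ, n = k ∧ q k} with h' | h'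
    · rw [h', sInf_empty, max_eq_right le_top]
      exact le_top
    obtain ⟨k, hk, hpk⟩ := csInf_mem h
    obtain ⟨l, hl, hql⟩ := csInf_mem h'
    rw [hk, hl]
    exact sInf_le ⟨max k l, (Nat.mono_cast.map_max).symm, Nat.le_induction hpk (fun n _ ↦ hp n) _ (le_max_left k l),
      Nat.le_induction hql (fun n _ ↦ hq n) _ (le_max_right k l)⟩
  · exact max_le (sInf_le_sInf fun _ ⟨k, hk, h⟩ ↦ ⟨k, hk, h.1⟩)
      (sInf_le_sInf fun _ ⟨k, hk, h⟩ ↦ ⟨k, hk, h.2⟩)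

/-- `Tor` in positive degree is computed by tensoring a projective resolution. -/
lemma isZero_tor_succ_iff {R : Type u} [CommRing R] (A : Type u) [AddCommGroup A] [Module R A]
    {X : ModuleCat.{u} R} (P : ProjectiveResolution X) (n : ℕ) :
    Limits.IsZero (((Tor (ModuleCat.{u} R) (n + 1)).obj (ModuleCat.of R A)).obj X) ↔
      Function.Exact ((P.complex.d (n + 2) (n + 1)).hom.lTensor A)
        ((P.complex.d (n + 1) n).hom.lTensor A) :=
  (P.isZero_leftDerived_succ_iff _ n).trans
    (ShortComplex.ShortExact.moduleCat_exact_iff_function_exact _)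

/-- For a pure exact sequence `0 → L → M → N → 0` of `R`-modules,
`w.d.(M) = max (w.d.(L), w.d.(N))`. -/
theorem weakDim_of_pure_exact (R : Type u) [CommRing R]
    (L M N : Type u) [AddCommGroup L] [Module R L] [AddCommGroup M] [Module R M]
    [AddCommGroup N] [Module R N]
    (f : L →ₗ[R] M) (g : M →ₗ[R] N)
    (hf : Function.Injective f) (hg : Function.Surjective g)
    (hfg : Function.Exact f g)
    (hpure : ∀ (T : Type u) [AddCommGroup T] [Module R T],
      Function.Injective (LinearMap.rTensor T f)) :
    weakDim R M = max (weakDim R L) (weakDim R N) := by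
  have key (k : ℕ) (X : ModuleCat.{u} R) :
      Limits.IsZero (((Tor (ModuleCat.{u} R) (k + 1)).obj (ModuleCat.of R M)).obj X) ↔
        Limits.IsZero (((Tor (ModuleCat.{u} R) (k + 1)).obj (ModuleCat.of R L)).obj X) ∧
          Limits.IsZero (((Tor (ModuleCat.{u} R) (k + 1)).obj (ModuleCat.of R N)).obj X) := by
    let P := projectiveResolution X
    simp only [isZero_tor_succ_iff _ P]
    exact exact_lTensor_iff_of_pure_exact hg hfg
      (by rw [← ModuleCat.hom_comp, P.complex.d_comp_d, ModuleCat.hom_zero])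
      (hpure _) (hpure _) (hpure _)
  simp only [weakDim, key, forall_and]
  exact ENat.sInf_coe_and_eq_max (fun _ h ↦ Functor.isZero_leftDerived_succ_of_forall _ h)
    (fun _ h ↦ Functor.isZero_leftDerived_succ_of_forall _ h)
end

section
/- Let R be a chain ring which is semicoherent and whose set of zero-divisors Z is nonzero. Then the R-module R/Z has infinite weak dimension: w.d.(R/Z) = ∞. -/
open CategoryTheory

universe u

namespace IsChainRing

variable {R : Type u} [CommRing R]

theorem dvd_total (hR : IsChainRing R) (a b : R) : a ∣ b ∨ b ∣ a := by
  simpa only [Ideal.span_singleton_le_span_singleton, or_comm] using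
    hR (Ideal.span {a}) (Ideal.span {b})

theorem exists_eq_smul_of_mem_smul_top (hR : IsChainRing R) {M : Type*} [AddCommGroup M]
    [Module R M] (I : Ideal R) {x : M} (hx : x ∈ I • (⊤ : Submodule R M)) :
    ∃ b ∈ I, ∃ v : M, x = b • v := by
  refine Submodule.smul_induction_on hx (fun b hb v _ => ⟨b, hb, v, rfl⟩) ?_
  rintro _ _ ⟨b, hb, v, rfl⟩ ⟨c, hc, w, rfl⟩
  obtain ⟨t, rfl⟩ | ⟨t, rfl⟩ := hR.dvd_total b c
  · exact ⟨b, hb, v + t • w, by rw [smul_add, mul_smul]⟩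
  · exact ⟨c, hc, t • v + w, by rw [smul_add, mul_smul]⟩

theorem exists_eq_smul_of_smul_eq_zero (hR : IsChainRing R) {M : Type*} [AddCommGroup M]
    [Module R M] [Module.Flat R M] {b : R} {x : M} (hx : b • x = 0) :
    ∃ c : R, b * c = 0 ∧ ∃ v : M, x = c • v := by
  obtain ⟨k, a, y, hy, ha⟩ := Module.Flat.isTrivialRelation_of_sum_smul_eq_zero
    (f := fun _ : Unit => b) (x := fun _ => x) (by simpa using hx)
  have hmem : x ∈ LinearMap.ker (LinearMap.mulLeft R b) • (⊤ : Submodule R M) := by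
    rw [show x = _ from hy ()]
    exact Submodule.sum_mem _ fun j _ => Submodule.smul_mem_smul (by simpa using ha j) trivial
  obtain ⟨c, hc, v, h⟩ := hR.exists_eq_smul_of_mem_smul_top _ hmem
  exact ⟨c, by simpa using hc, v, h⟩

end IsChainRing

open nonZeroDivisors

section

variable {R : Type u} [CommRing R]

/-- `IsLocalAnnihilator a b` says that the annihilator of `a` is generated by `b` over the total
ring of fractions of `R`. -/
def IsLocalAnnihilator (a b : R) : Prop :=
  a * b = 0 ∧ ∀ y : R, a * y = 0 → ∃ s ∈ R⁰, b ∣ s * y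

theorem IsLocalAnnihilator.symm (hR : IsChainRing R) {a b : R} (ha : a ≠ 0)
    (h : IsLocalAnnihilator a b) : IsLocalAnnihilator b a := by
  refine ⟨by rw [mul_comm, h.1], fun y hy => ?_⟩
  obtain ⟨t, rfl⟩ | ⟨t, rfl⟩ := hR.dvd_total a y
  · exact ⟨1, one_mem _, by simp⟩
  refine ⟨t, ?_, by rw [mul_comm]⟩
  rw [mem_nonZeroDivisors_iff_right]
  intro d hd
  obtain ⟨g, rfl⟩ | ⟨g, rfl⟩ := hR.dvd_total y d
  · obtain ⟨s, hs, u, hu⟩ := h.2 g (by linear_combination hd)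
    refine (mem_nonZeroDivisors_iff_right.mp hs) _ ?_
    linear_combination y * hu + u * hy
  · exact absurd (by linear_combination g * hd) ha

theorem IsLocalAnnihilator.of_annihilator_mul_eq_zero (hR : IsChainRing R) {a b : R} (hb : b ≠ 0)
    (hab : a * b = 0) (h : ∀ s, b * s = 0 → ∀ y, a * y = 0 → s * y = 0) :
    IsLocalAnnihilator a b := by
  refine ⟨hab, fun y hy => ?_⟩
  obtain ⟨t, rfl⟩ | ⟨t, rfl⟩ := hR.dvd_total b y
  · exact ⟨1, one_mem _, by simp⟩
  refine ⟨t, ?_, by rw [mul_comm]⟩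
  rw [mem_nonZeroDivisors_iff_right]
  intro d hd
  obtain ⟨g, rfl⟩ | ⟨g, rfl⟩ := hR.dvd_total y d
  · linear_combination h g (by linear_combination hd) y hy
  · exact absurd (by linear_combination g * hd) hb

theorem IsSemicoherent.exists_isLocalAnnihilator (hsc : IsSemicoherent R) (hR : IsChainRing R)
    {r : R} (hr : r ∉ R⁰) : ∃ a : R, IsLocalAnnihilator r a := by
  let j := Injective.ι (ModuleCat.of R R)
  let E := Injective.under (ModuleCat.of R R)
  let L : Submodule R E := LinearMap.range (LinearMap.lsmul R E r)
  let i := Injective.ι (ModuleCat.of R (E ⧸ L))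
  let F := Injective.under (ModuleCat.of R (E ⧸ L))
  have hj : Function.Injective j.hom := (ModuleCat.mono_iff_injective j).mp inferInstance
  have hi : Function.Injective i.hom := (ModuleCat.mono_iff_injective i).mp inferInstance
  have hE : Module.Injective R E :=
    have : Injective (ModuleCat.of R E) := inferInstanceAs (Injective E)
    Module.injective_module_of_injective_object R E
  have hF : Module.Injective R F :=
    have : Injective (ModuleCat.of R F) := inferInstanceAs (Injective F)
    Module.injective_module_of_injective_object R F
  obtain ⟨W, _, _, hW, f, hf⟩ := hsc E F hE hF
  let φ : E →ₗ[R] F := i.hom ∘ₗ L.mkQ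
  have hφ : ∀ (s : R) (x : E), s • φ x = 0 ↔ s • x ∈ L := by
    intro s x
    rw [← map_smul, LinearMap.comp_apply, map_eq_zero_iff _ hi, Submodule.mkQ_apply,
      Submodule.Quotient.mk_eq_zero]
  have hrφ : r • φ = 0 := LinearMap.ext fun x => (hφ r x).mpr ⟨x, rfl⟩
  obtain ⟨a, hra, w, hw⟩ := hR.exists_eq_smul_of_smul_eq_zero (b := r) (x := f φ)
    (by rw [← map_smul, hrφ, map_zero])
  have key : ∀ s, a * s = 0 → ∀ y, r * y = 0 → s * y = 0 := by
    intro s hs y hy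
    have hsφ : s • φ = 0 := hf (by rw [map_smul, hw, smul_smul, mul_comm, hs, zero_smul, map_zero])
    obtain ⟨x, hx⟩ := (hφ s (j.hom (1 : R))).mp (LinearMap.congr_fun hsφ _)
    apply hj
    have hx' : r • x = s • j.hom (1 : R) := hx
    calc j.hom (s * y : R) = j.hom (y • s • (1 : R)) := by simp [mul_comm]
      _ = y • r • x := by rw [map_smul, map_smul, hx']
      _ = j.hom 0 := by rw [smul_smul, mul_comm, hy, zero_smul, map_zero]
  refine ⟨a, .of_annihilator_mul_eq_zero hR ?_ hra key⟩
  rintro rfl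
  refine hr (mem_nonZeroDivisors_iff_left.mpr fun y hy => ?_)
  simpa using key 1 (by simp) y hy

/-- `RelationsGeneratedBy a d x`: relations on the class of `x` modulo the range of `d` are those of a
generator of a cyclic module with annihilator `a`, up to non-zero-divisors. -/
def RelationsGeneratedBy (a : R) {P P' : Type*} [AddCommGroup P] [Module R P] [AddCommGroup P']
    [Module R P'] (d : P' →ₗ[R] P) (x : P) : Prop :=
  ∀ (c b : R) (w : P') (v : P), c • x = d w + b • v →
    ∃ s ∈ R⁰, ∃ p q : R, s * c = a * p + b * q

theorem RelationsGeneratedBy.step (hR : IsChainRing R)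
    (hsub : ∀ s ∈ R⁰, ∀ z ∉ R⁰, s - z ∈ R⁰)
    {a a' : R} (ha : a ∉ R⁰) (haa' : IsLocalAnnihilator a a') {P P' P'' : Type*}
    [AddCommGroup P] [Module R P] [AddCommGroup P'] [Module R P'] [AddCommGroup P'']
    [Module R P''] [Module.Flat R P] {d : P' →ₗ[R] P} {d' : P'' →ₗ[R] P'}
    (hdd : ∀ w, d (d' w) = 0) {x : P} {y : P'} (hx : RelationsGeneratedBy a d x)
    (hy : d y = a • x) : RelationsGeneratedBy a' d' y := by
  intro c b w v h
  have h1 : c • a • x = b • d v := by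
    rw [← hy, ← map_smul, h, map_add, hdd, zero_add, map_smul]
  obtain ⟨e, he⟩ | ⟨e, he⟩ := hR.dvd_total (c * a) b
  · obtain ⟨b', hb', v', hv'⟩ := hR.exists_eq_smul_of_smul_eq_zero (b := c * a)
      (x := x - e • d v) (by rw [smul_sub, smul_smul, ← he, mul_smul, h1, sub_self])
    obtain ⟨s, hs, p, q, hpq⟩ := hx 1 b' (e • v) v' (by
      rw [← hv', map_smul, one_smul, add_sub_cancel])
    have hap : a * p ∉ R⁰ := fun hh => ha (mul_mem_nonZeroDivisors.mp hh).1
    obtain ⟨s', hs', u, hu⟩ := haa'.2 ((s - a * p) * c) (by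
      linear_combination c * a * hpq + q * hb')
    exact ⟨s' * (s - a * p), mul_mem hs' (hsub s hs _ hap), u, 0, by linear_combination hu⟩
  · obtain ⟨b', hb', v', hv'⟩ := hR.exists_eq_smul_of_smul_eq_zero (b := b)
      (x := e • x - d v) (by rw [smul_sub, smul_smul, ← he, mul_smul, h1, sub_self])
    obtain ⟨s, hs, p, q, hpq⟩ := hx e b' v v' (by rw [← hv', add_sub_cancel])
    obtain ⟨s', hs', u, hu⟩ := haa'.2 (s * c - b * p) (by
      linear_combination s * he + b * hpq + q * hb')
    exact ⟨s' * s, mul_mem hs' hs, u, s' * p, by linear_combination hu⟩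

open MonoidalCategory in
theorem not_isZero_Tor_of_isLocalAnnihilator (hR : IsChainRing R) (Z : Ideal R)
    (hZ : ∀ z, z ∈ Z ↔ z ∉ R⁰) (a : ℕ → R) (ha : ∀ n, a n ∈ Z)
    (haa : ∀ n, IsLocalAnnihilator (a n) (a (n + 1))) (k : ℕ) :
    ¬ Limits.IsZero (((Tor (ModuleCat.{u} R) (k + 1)).obj (ModuleCat.of R (R ⧸ Z))).obj
      (ModuleCat.of R (R ⧸ Ideal.span {a 0}))) := by
  intro hzero
  let N := ModuleCat.of R (R ⧸ Ideal.span {a 0})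
  let A := ModuleCat.of R (R ⧸ Z)
  let P : ProjectiveResolution N := projectiveResolution N
  let d (n : ℕ) : P.complex.X (n + 1) →ₗ[R] P.complex.X n := (P.complex.d (n + 1) n).hom
  have hflat (n : ℕ) : Module.Flat R (P.complex.X n) :=
    have := ModuleCat.projective_of_module_projective (P.complex.X n)
    inferInstance
  have hdd (n : ℕ) (w) : d n (d (n + 1) w) = 0 :=
    LinearMap.congr_fun (ModuleCat.hom_ext_iff.mp (P.complex.d_comp_d (n + 2) (n + 1) n)) w
  have hex (n : ℕ) (x) (hx : d n x = 0) : ∃ y, d (n + 1) y = x :=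
    (ShortComplex.moduleCat_exact_iff _).mp (P.exact_succ n) x hx
  let ε : P.complex.X 0 →ₗ[R] R ⧸ Ideal.span {a 0} := (P.π.f 0).hom
  have hεd (w) : ε (d 0 w) = 0 :=
    LinearMap.congr_fun (ModuleCat.hom_ext_iff.mp P.complex_d_comp_π_f_zero) w
  have hεex (x) (hx : ε x = 0) : ∃ y, d 0 y = x :=
    (ShortComplex.moduleCat_exact_iff _).mp P.exact₀ x hx
  have hε : Function.Surjective ε := (ModuleCat.epi_iff_surjective (P.π.f 0)).mp inferInstance
  have hsub : ∀ s ∈ R⁰, ∀ z ∉ R⁰, s - z ∈ R⁰ := by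
    intro s hs z hz
    by_contra h
    exact (hZ s).mp (by simpa using Z.add_mem ((hZ _).mpr h) ((hZ _).mpr hz)) hs
  have main (n : ℕ) : ∃ x, RelationsGeneratedBy (a n) (d n) x ∧ ∃ y, d n y = a n • x := by
    induction n with
    | zero =>
      obtain ⟨x, hx⟩ := hε 1
      refine ⟨x, fun c b w v h => ?_, hεex _ ?_⟩
      · obtain ⟨t, ht⟩ := Ideal.Quotient.mk_surjective (ε v)
        have h1 : Ideal.Quotient.mk (Ideal.span {a 0}) c =
            Ideal.Quotient.mk (Ideal.span {a 0}) (b * t) := by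
          have := congrArg ε h
          rw [map_smul, map_add, hεd, zero_add, map_smul, hx, ← ht] at this
          simpa [Algebra.smul_def] using this
        obtain ⟨p, hp⟩ := Ideal.mem_span_singleton.mp (Ideal.Quotient.eq.mp h1)
        exact ⟨1, one_mem _, p, t, by linear_combination hp⟩
      · rw [map_smul, hx, Algebra.smul_def, mul_one]
        exact Ideal.Quotient.eq_zero_iff_mem.mpr (Ideal.mem_span_singleton_self _)
    | succ n ih =>
      obtain ⟨x, hx, y, hy⟩ := ih
      refine ⟨y, hx.step hR hsub ((hZ _).mp (ha n)) (haa n) (hdd n) hy, hex n _ ?_⟩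
      rw [map_smul, hy, smul_smul, mul_comm, (haa n).1, zero_smul]
  obtain ⟨x, hx, y, hy⟩ := main k
  have hy' := hx.step hR hsub ((hZ _).mp (ha k)) (haa k) (hdd k) hy
  have hexact : (((tensoringLeft (ModuleCat.{u} R)).obj A).mapHomologicalComplex _ |>.obj
      P.complex).ExactAt (k + 1) := by
    rw [HomologicalComplex.exactAt_iff_isZero_homology]
    exact hzero.of_iso (P.isoLeftDerivedObj ((tensoringLeft (ModuleCat.{u} R)).obj A) (k + 1)).symm
  rw [HomologicalComplex.exactAt_iff' _ (k + 2) (k + 1) k (by simp) (by simp),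
    ShortComplex.moduleCat_exact_iff] at hexact
  obtain ⟨w', hw'⟩ : ∃ w', (d (k + 1)).lTensor (R ⧸ Z) w' = (1 : R ⧸ Z) ⊗ₜ[R] y := by
    refine hexact ((1 : R ⧸ Z) ⊗ₜ[R] y) ?_
    change (d k).lTensor (R ⧸ Z) ((1 : R ⧸ Z) ⊗ₜ[R] y) = 0
    rw [LinearMap.lTensor_tmul, hy, ← TensorProduct.smul_tmul, Algebra.smul_def, mul_one]
    rw [show algebraMap R (R ⧸ Z) (a k) = 0 from Ideal.Quotient.eq_zero_iff_mem.mpr (ha k),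
      TensorProduct.zero_tmul]
  obtain ⟨w, rfl⟩ : ∃ w, (1 : R ⧸ Z) ⊗ₜ[R] w = w' :=
    TensorProduct.mk_surjective R _ _ Ideal.Quotient.mk_surjective w'
  have hmem : y - d (k + 1) w ∈ Z • (⊤ : Submodule R (P.complex.X (k + 1))) := by
    rw [← Submodule.Quotient.mk_eq_zero, ← TensorProduct.quotTensorEquivQuotSMul_mk_one_tmul,
      TensorProduct.tmul_sub, ← hw', LinearMap.lTensor_tmul, sub_self, map_zero]
  obtain ⟨b, hb, v, hv⟩ := hR.exists_eq_smul_of_mem_smul_top Z hmem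
  obtain ⟨s, hs, p, q, hpq⟩ := hy' 1 b w v (by rw [← hv, one_smul, add_sub_cancel])
  refine (hZ s).mp ?_ hs
  rw [← mul_one s, hpq]
  exact Z.add_mem (Z.mul_mem_right _ (ha _)) (Z.mul_mem_right _ hb)

end

/-- If `R` is a semicoherent chain ring whose ideal `Z` of zero-divisors
is nonzero, then `w.d.(R/Z) = ∞`. -/
theorem weakDim_quotient_zeroDivisors_eq_top (R : Type u) [CommRing R]
    (hR : IsChainRing R) (hsc : IsSemicoherent R)
    (Z : Ideal R) (hZ : (Z : Set R) = zeroDivisorsSet R) (hZ0 : Z ≠ ⊥) :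
    weakDim R (R ⧸ Z) = ⊤ := by
  have hZ' : ∀ z, z ∈ Z ↔ z ∉ R⁰ := by
    intro z
    rw [← SetLike.mem_coe, hZ, mem_nonZeroDivisors_iff_left]
    simp [zeroDivisorsSet, and_comm]
  obtain ⟨r, hr, hr0⟩ := Submodule.exists_mem_ne_zero_of_ne_bot hZ0
  obtain ⟨a, ha⟩ := hsc.exists_isLocalAnnihilator hR ((hZ' r).mp hr)
  have haZ : a ∈ Z := (hZ' a).mpr fun h =>
    hr0 (mem_nonZeroDivisors_iff_right.mp h r ha.1)
  let α (n : ℕ) : R := if Even n then r else a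
  have hα (n : ℕ) : α n ∈ Z := by
    by_cases hn : Even n <;> simp [α, hn, hr, haZ]
  have hαα (n : ℕ) : IsLocalAnnihilator (α n) (α (n + 1)) := by
    by_cases hn : Even n <;> simp [α, hn, Nat.even_add_one, ha, ha.symm hR hr0]
  rw [weakDim, sInf_eq_top]
  rintro _ ⟨k, -, hk⟩
  exact absurd (hk _) (not_isZero_Tor_of_isLocalAnnihilator hR Z hZ' α hα hαα k)
end

section
/- Let R be a chain ring which is not semicoherent, and let Z be its set of zero-divisors. Then the R-module R/Z has weak dimension exactly 1: w.d.(R/Z) = 1. -/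
open CategoryTheory

universe u

open TensorProduct in
/-- Over a chain ring, flatness can be checked on relations with a single term. -/
theorem flat_of_smul_eq_zero {A : Type*} [CommRing A] [PreValuationRing A]
    {M : Type*} [AddCommGroup M] [Module A M]
    (h : ∀ (r : A) (x : M), r • x = 0 → ∃ (c : A) (y : M), c * r = 0 ∧ x = c • y) :
    Module.Flat A M := by
  rw [Module.Flat.iff_rTensor_injective]
  intro I hI
  have : ∃ r, I = Ideal.span {r} := by
    have : IsBezout A := IsBezout.iff_span_pair_isPrincipal.mpr fun a b => by
      obtain ⟨c, rfl | rfl⟩ := PreValuationRing.cond a b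
      · exact ⟨a, by rw [Ideal.span_pair_eq_span_left_iff_dvd.mpr (Dvd.intro _ rfl)]⟩
      · exact ⟨b, by rw [Ideal.span_pair_eq_span_right_iff_dvd.mpr (Dvd.intro _ rfl)]⟩
    exact (IsBezout.isPrincipal_of_FG I hI).principal
  obtain ⟨r, rfl⟩ := this
  let r' : Ideal.span {r} := ⟨r, Ideal.mem_span_singleton_self r⟩
  rw [injective_iff_map_eq_zero]
  intro t ht
  obtain ⟨x, rfl⟩ : ∃ x : M, t = r' ⊗ₜ[A] x := by
    clear ht
    induction t with
    | zero => exact ⟨0, by simp⟩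
    | tmul a x =>
      obtain ⟨a, ha⟩ := a
      obtain ⟨b, rfl⟩ := Ideal.mem_span_singleton'.mp ha
      refine ⟨b • x, ?_⟩
      rw [← TensorProduct.smul_tmul]
      rfl
    | add s t hs ht =>
      obtain ⟨x, rfl⟩ := hs
      obtain ⟨y, rfl⟩ := ht
      exact ⟨x + y, by rw [TensorProduct.tmul_add]⟩
  have hx : r • x = 0 := by
    have := congrArg (TensorProduct.lid A M) ht
    simpa using this
  obtain ⟨c, y, hc, rfl⟩ := h r x hx
  rw [← TensorProduct.smul_tmul]
  have : c • r' = 0 := Subtype.ext hc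
  rw [this, TensorProduct.zero_tmul]

/-- In a chain ring whose non-units are zero-divisors, principal ideals are annihilators. -/
theorem dvd_of_annihilator_le {A : Type*} [CommRing A] [PreValuationRing A]
    (hA : ∀ t : A, ¬ IsUnit t → ∃ u, u ≠ 0 ∧ t * u = 0) {r s : A}
    (h : ∀ x, r * x = 0 → s * x = 0) : r ∣ s := by
  obtain ⟨t, ht | ht⟩ := PreValuationRing.cond r s
  · exact ⟨t, ht.symm⟩
  by_cases hu : IsUnit t
  · exact (hu.dvd_mul_right.mpr dvd_rfl).trans (ht ▸ by simp [hu.mul_right_dvd])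
  subst ht
  obtain ⟨u, hu0, htu⟩ := hA t hu
  obtain ⟨y, hy | hy⟩ := PreValuationRing.cond s u
  · refine absurd ?_ hu0
    rw [← hy]
    apply h
    rw [← htu, ← hy]
    ring
  · have h1 := h 1 (by rw [← hy]; linear_combination y * htu)
    rw [mul_one] at h1
    simp [h1]

/-- If one nonzero element of a chain ring has a nonzero principal annihilator,
then so does every element. -/
theorem exists_annihilator_eq_of_exists {A : Type*} [CommRing A] [PreValuationRing A]
    {r a : A} (hr : r ≠ 0) (ha : a ≠ 0) (hra : ∀ x, r * x = 0 ↔ a ∣ x) (s : A) :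
    ∃ b, ∀ x, s * x = 0 ↔ b ∣ x := by
  by_cases hs : s = 0
  · exact ⟨1, by simp [hs]⟩
  obtain ⟨t, ht | ht⟩ := PreValuationRing.cond r s
  · subst ht
    obtain ⟨b, hb | hb⟩ := PreValuationRing.cond t a
    · subst hb
      refine ⟨b, fun x => ⟨fun hx => ?_, ?_⟩⟩
      · obtain ⟨q, hq⟩ := (hra (t * x)).mp (by rw [← hx]; ring)
        obtain ⟨c, hc | hc⟩ := PreValuationRing.cond b (x - b * q)
        · exact ⟨c + q, by linear_combination -hc⟩
        · exact absurd (by rw [← hc]; linear_combination c * hq) ha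
      · rintro ⟨c, rfl⟩
        have := (hra (t * b)).mpr dvd_rfl
        linear_combination c * this
    · refine absurd ?_ hs
      have := (hra a).mpr dvd_rfl
      rw [← hb]
      linear_combination b * this
  · subst ht
    refine ⟨t * a, fun x => ⟨fun hx => ?_, ?_⟩⟩
    · obtain ⟨y, hy | hy⟩ := PreValuationRing.cond t x
      · rw [← hy]
        exact mul_dvd_mul_left t ((hra y).mp (by rw [← hx, ← hy]; ring))
      · exact absurd (by rw [← hy]; linear_combination y * hx) hr
    · rintro ⟨c, rfl⟩
      have := (hra a).mpr dvd_rfl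
      linear_combination c * this

/-- A chain ring whose non-units are zero-divisors and whose elements all have principal
annihilators is an IF-ring. -/
theorem isIFRing_of_annihilator {A : Type u} [CommRing A] [PreValuationRing A]
    (hA : ∀ t : A, ¬ IsUnit t → ∃ u, u ≠ 0 ∧ t * u = 0)
    (hann : ∀ s : A, ∃ b, ∀ x, s * x = 0 ↔ b ∣ x) : IsIFRing A := by
  intro M _ _ hM
  refine flat_of_smul_eq_zero fun r x hrx => ?_
  obtain ⟨b, hb⟩ := hann r
  have hbr : r * b = 0 := (hb b).mpr dvd_rfl
  have hker : LinearMap.ker (LinearMap.toSpanSingleton A A b) ≤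
      LinearMap.ker (LinearMap.toSpanSingleton A M x) := by
    intro q hq
    simp only [LinearMap.mem_ker, LinearMap.toSpanSingleton_apply, smul_eq_mul] at hq ⊢
    obtain ⟨c, rfl⟩ : r ∣ q := by
      refine dvd_of_annihilator_le hA fun y hy => ?_
      obtain ⟨d, rfl⟩ := (hb y).mp hy
      linear_combination d * hq
    rw [mul_comm, mul_smul, hrx, smul_zero]
  let K := LinearMap.ker (LinearMap.toSpanSingleton A A b)
  obtain ⟨g, hg⟩ := hM.out (K.liftQ (LinearMap.toSpanSingleton A A b) le_rfl)
    (LinearMap.ker_eq_bot.mp (Submodule.ker_liftQ_eq_bot _ _ _ le_rfl))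
    (K.liftQ (LinearMap.toSpanSingleton A M x) hker)
  refine ⟨b, g 1, by rw [mul_comm, hbr], ?_⟩
  have := hg (K.mkQ 1)
  simp only [Submodule.mkQ_apply, Submodule.liftQ_apply, LinearMap.toSpanSingleton_apply,
    one_smul] at this
  rw [← this, ← map_smul, smul_eq_mul, mul_one]

/-- Injective modules are divisible by regular elements. -/
theorem exists_smul_eq_of_injective {R E : Type u} [CommRing R] [AddCommGroup E] [Module R E]
    (hE : Module.Injective R E) {c : R} (hc : c ∈ nonZeroDivisors R) (x : E) :
    ∃ y : E, c • y = x := by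
  obtain ⟨g, hg⟩ := hE.out (LinearMap.mulLeft R c)
    (fun a b hab => (mul_cancel_left_mem_nonZeroDivisors hc).mp hab)
    (LinearMap.toSpanSingleton R E x)
  refine ⟨g 1, ?_⟩
  have := hg 1
  simp only [LinearMap.mulLeft_apply, mul_one, LinearMap.toSpanSingleton_apply, one_smul] at this
  rw [← map_smul, smul_eq_mul, mul_one, this]

/-- A ring whose total quotient ring is an IF-ring is semicoherent. -/
theorem isSemicoherent_of_isIFRing_localization {R : Type u} [CommRing R]
    (h : IsIFRing (Localization (nonZeroDivisors R))) : IsSemicoherent R := by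
  intro E F _ _ _ _ hE _
  let Q := Localization (nonZeroDivisors R)
  let L := LocalizedModule (nonZeroDivisors R) (E →ₗ[R] F)
  let I : ModuleCat.{u} Q := Injective.under (ModuleCat.of Q L)
  let ι : L →ₗ[Q] I := (Injective.ι (ModuleCat.of Q L)).hom
  have hι : Function.Injective ι := (ModuleCat.mono_iff_injective _).mp inferInstance
  have hI : Module.Injective Q I := (Module.injective_iff_injective_object Q I).mpr
    (inferInstanceAs (Injective (Injective.under (ModuleCat.of Q L))))
  have hflat : Module.Flat Q I := h I hI
  let _ : Module R I := Module.compHom I (algebraMap R Q)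
  have : IsScalarTower R Q I := IsScalarTower.of_algebraMap_smul fun _ _ => rfl
  have : Module.Flat R Q := IsLocalization.flat Q (nonZeroDivisors R)
  refine ⟨I, inferInstance, inferInstance, Module.Flat.trans R Q I,
    (ι.restrictScalars R) ∘ₗ LocalizedModule.mkLinearMap (nonZeroDivisors R) (E →ₗ[R] F), ?_⟩
  refine hι.comp ?_
  rw [injective_iff_map_eq_zero]
  intro f hf
  obtain ⟨c, hc⟩ := (IsLocalizedModule.eq_zero_iff (nonZeroDivisors R) _).mp hf
  ext x
  obtain ⟨y, rfl⟩ := exists_smul_eq_of_injective hE c.2 x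
  rw [map_smul]
  exact LinearMap.congr_fun hc y

open TensorProduct in
/-- Vanishing of `Tor` as exactness of a tensored projective resolution. -/
theorem isZero_Tor_succ_iff {R : Type u} [CommRing R] (M N : ModuleCat.{u} R)
    (P : ProjectiveResolution N) (n : ℕ) :
    Limits.IsZero (((Tor (ModuleCat.{u} R) (n + 1)).obj M).obj N) ↔
      Function.Exact ((P.complex.d (n + 2) (n + 1)).hom.lTensor M)
        ((P.complex.d (n + 1) n).hom.lTensor M) := by
  refine (Iso.isZero_iff (P.isoLeftDerivedObj
    ((MonoidalCategory.tensoringLeft (ModuleCat.{u} R)).obj M) (n + 1))).trans ?_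
  refine (HomologicalComplex.exactAt_iff_isZero_homology _ _).symm.trans ?_
  rw [HomologicalComplex.exactAt_iff' _ (n + 2) (n + 1) n (by simp) (by simp),
    ShortComplex.ShortExact.moduleCat_exact_iff_function_exact]
  rfl

open TensorProduct in
/-- The two partial tensor products of linear maps commute. -/
theorem lTensor_rTensor_comm_apply {R M N X Y : Type*} [CommRing R] [AddCommGroup M] [Module R M]
    [AddCommGroup N] [Module R N] [AddCommGroup X] [Module R X] [AddCommGroup Y] [Module R Y]
    (p : M →ₗ[R] N) (q : X →ₗ[R] Y) (t : M ⊗[R] X) :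
    q.lTensor N (p.rTensor X t) = p.rTensor Y (q.lTensor M t) := by
  rw [← LinearMap.comp_apply, ← LinearMap.comp_apply, LinearMap.lTensor_comp_rTensor,
    LinearMap.rTensor_comp_lTensor]

/-- Tensoring a quotient of flat modules with an exact sequence ending in a flat module
preserves exactness one step earlier. -/
theorem lTensor_exact_of_flat_kernel {R A B C X₃ X₂ X₁ X₀ : Type*} [CommRing R]
    [AddCommGroup A] [Module R A] [AddCommGroup B] [Module R B] [AddCommGroup C] [Module R C]
    [AddCommGroup X₃] [Module R X₃] [AddCommGroup X₂] [Module R X₂]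
    [AddCommGroup X₁] [Module R X₁] [AddCommGroup X₀] [Module R X₀]
    [Module.Flat R A] [Module.Flat R B] [Module.Flat R X₀]
    {f : A →ₗ[R] B} {g : B →ₗ[R] C} (hf : Function.Injective f) (hfg : Function.Exact f g)
    (hg : Function.Surjective g)
    {d₃ : X₃ →ₗ[R] X₂} {d₂ : X₂ →ₗ[R] X₁} {d₁ : X₁ →ₗ[R] X₀}
    (h₃₂ : Function.Exact d₃ d₂) (h₂₁ : Function.Exact d₂ d₁) :
    Function.Exact (d₃.lTensor C) (d₂.lTensor C) := by
  intro t
  constructor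
  · intro ht
    obtain ⟨s, rfl⟩ := LinearMap.rTensor_surjective X₂ hg t
    rw [lTensor_rTensor_comm_apply] at ht
    obtain ⟨v, hv⟩ := (rTensor_exact X₁ hfg hg _).mp ht
    have hv0 : d₁.lTensor A v = 0 := by
      apply Module.Flat.rTensor_preserves_injective_linearMap (M := X₀) f hf
      rw [← lTensor_rTensor_comm_apply, hv, map_zero]
      exact (Module.Flat.lTensor_exact B h₂₁ _).mpr ⟨s, rfl⟩
    obtain ⟨w, rfl⟩ := (Module.Flat.lTensor_exact A h₂₁ _).mp hv0
    obtain ⟨y, hy⟩ := (Module.Flat.lTensor_exact B h₃₂ (s - f.rTensor X₂ w)).mp (by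
      rw [map_sub, lTensor_rTensor_comm_apply, hv, sub_self])
    refine ⟨g.rTensor X₃ y, ?_⟩
    rw [lTensor_rTensor_comm_apply, hy, map_sub, (rTensor_exact X₂ hfg hg _).mpr ⟨w, rfl⟩, sub_zero]
  · rintro ⟨x, rfl⟩
    rw [← LinearMap.comp_apply, ← LinearMap.lTensor_comp, h₃₂.linearMap_comp_eq_zero,
      LinearMap.lTensor_zero, LinearMap.zero_apply]

/-- A projective resolution of modules is exact in positive degrees. -/
theorem projectiveResolution_function_exact_succ {R : Type u} [CommRing R] {N : ModuleCat.{u} R}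
    (P : ProjectiveResolution N) (n : ℕ) :
    Function.Exact (P.complex.d (n + 2) (n + 1)).hom (P.complex.d (n + 1) n).hom :=
  (ShortComplex.ShortExact.moduleCat_exact_iff_function_exact _).mp (P.exact_succ n)

/-- If an ideal `I` is flat then `Tor₂(R/I, N)` vanishes. -/
theorem isZero_Tor_two_quotient {R : Type u} [CommRing R] (I : Ideal R) [Module.Flat R I]
    (N : ModuleCat.{u} R) :
    Limits.IsZero (((Tor (ModuleCat.{u} R) 2).obj (ModuleCat.of R (R ⧸ I))).obj N) := by
  let P := projectiveResolution N
  have : Module.Projective R (P.complex.X 0) :=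
    (IsProjective.iff_projective _).mpr (P.projective 0)
  rw [isZero_Tor_succ_iff _ _ P 1]
  exact lTensor_exact_of_flat_kernel I.injective_subtype
    (LinearMap.exact_subtype_mkQ I) I.mkQ_surjective
    (projectiveResolution_function_exact_succ P 1) (projectiveResolution_function_exact_succ P 0)

open TensorProduct in
/-- If `Tor₁(R/I, R/rR)` vanishes and `r ∈ I`, then `r (1 - z) = 0` for some `z ∈ I`. -/
theorem exists_mul_eq_of_isZero_Tor_one {R : Type u} [CommRing R] (I : Ideal R) {r : R}
    (hr : r ∈ I)
    (h : Limits.IsZero (((Tor (ModuleCat.{u} R) 1).obj (ModuleCat.of R (R ⧸ I))).obj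
      (ModuleCat.of R (R ⧸ Ideal.span {r})))) :
    ∃ z ∈ I, r * (1 - z) = 0 := by
  let P := projectiveResolution (ModuleCat.of R (R ⧸ Ideal.span {r}))
  have hproj : Module.Projective R (P.complex.X 0) :=
    (IsProjective.iff_projective _).mpr (P.projective 0)
  rw [isZero_Tor_succ_iff _ _ P 0] at h
  let d₂ := (P.complex.d 2 1).hom
  let d₁ := (P.complex.d 1 0).hom
  let ε : P.complex.X 0 →ₗ[R] R ⧸ Ideal.span {r} := (P.π.f 0).hom
  have hε : Function.Surjective ε := (ModuleCat.epi_iff_surjective _).mp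
    (inferInstanceAs (Epi (P.π.f 0)))
  have hd₁ : Function.Exact d₁ ε :=
    (ShortComplex.ShortExact.moduleCat_exact_iff_function_exact _).mp P.exact₀
  have hd₂ : Function.Exact d₂ d₁ := projectiveResolution_function_exact_succ P 0
  obtain ⟨φ, hφ⟩ := Module.projective_lifting_property (Ideal.span {r}).mkQ ε
    (Submodule.mkQ_surjective _)
  obtain ⟨e, he⟩ := hε ((Ideal.span {r}).mkQ 1)
  obtain ⟨f, hf⟩ := (hd₁ (r • e)).mp (by
    rw [map_smul, he, ← map_smul, smul_eq_mul, mul_one]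
    exact (Submodule.Quotient.mk_eq_zero _).mpr (Ideal.mem_span_singleton_self r))
  obtain ⟨t, ht⟩ := (h ((1 : R ⧸ I) ⊗ₜ[R] f)).mp (by
    change (1 : R ⧸ I) ⊗ₜ[R] d₁ f = 0
    rw [hf, ← TensorProduct.smul_tmul]
    have : r • (1 : R ⧸ I) = 0 := by
      rw [Algebra.smul_def, mul_one]
      exact Ideal.Quotient.eq_zero_iff_mem.mpr hr
    rw [this, TensorProduct.zero_tmul])
  obtain ⟨g, rfl⟩ : ∃ g, t = (1 : R ⧸ I) ⊗ₜ[R] g := by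
    obtain ⟨s, rfl⟩ := LinearMap.rTensor_surjective _ I.mkQ_surjective t
    obtain ⟨g, rfl⟩ := (TensorProduct.lid R _).symm.surjective s
    exact ⟨g, by simp⟩
  have hmem : f - d₂ g ∈ I • (⊤ : Submodule R (P.complex.X 1)) := by
    rw [← Submodule.Quotient.mk_eq_zero]
    have h0 : (1 : R ⧸ I) ⊗ₜ[R] (f - d₂ g) = 0 := by
      rw [TensorProduct.tmul_sub, sub_eq_zero]
      exact ht.symm
    have := congrArg (TensorProduct.quotTensorEquivQuotSMul (P.complex.X 1) I) h0
    rw [map_zero, ← map_one (Ideal.Quotient.mk I),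
      TensorProduct.quotTensorEquivQuotSMul_mk_tmul, one_smul] at this
    exact this
  have hker (x : P.complex.X 0) (hx : ε x = 0) : φ x ∈ Ideal.span {r} := by
    rw [← hφ] at hx
    exact (Submodule.Quotient.mk_eq_zero _).mp hx
  have h1 : φ (d₁ (f - d₂ g)) ∈ I * Ideal.span {r} := by
    have := Submodule.mem_map_of_mem (f := φ ∘ₗ d₁) hmem
    rw [Submodule.map_smul''] at this
    refine Submodule.smul_mono le_rfl ?_ this
    rintro _ ⟨x, -, rfl⟩
    exact hker _ (hd₁.apply_apply_eq_zero x)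
  obtain ⟨z, hz, hzr⟩ := Ideal.mem_mul_span_singleton.mp h1
  have h2 : φ e - 1 ∈ Ideal.span {r} := by
    rw [← Submodule.Quotient.mk_eq_zero, Submodule.Quotient.mk_sub, sub_eq_zero]
    rw [← hφ] at he
    exact he
  obtain ⟨a, ha⟩ := Ideal.mem_span_singleton'.mp h2
  rw [map_sub, hd₂.apply_apply_eq_zero, sub_zero, hf, map_smul, smul_eq_mul] at hzr
  exact ⟨z - a * r, I.sub_mem hz (I.mul_mem_left a hr), by linear_combination r * ha - hzr⟩

/-- The total quotient ring of a chain ring is a chain ring. -/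
theorem preValuationRing_localization {R : Type*} [CommRing R] [PreValuationRing R]
    (S : Submonoid R) : PreValuationRing (Localization S) := by
  refine PreValuationRing.iff_dvd_total.mpr ⟨fun x y => ?_⟩
  obtain ⟨⟨a, s⟩, ha⟩ := IsLocalization.surj S x
  obtain ⟨⟨b, t⟩, hb⟩ := IsLocalization.surj S y
  have hs := IsLocalization.map_units (Localization S) s
  have ht := IsLocalization.map_units (Localization S) t
  have hab := (PreValuationRing.iff_dvd_total.mp ‹PreValuationRing R›).total a b
  rcases hab with h | h
  · left
    have := map_dvd (algebraMap R (Localization S)) h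
    rwa [← ha, ← hb, hs.mul_right_dvd, ht.dvd_mul_right] at this
  · right
    have := map_dvd (algebraMap R (Localization S)) h
    rwa [← ha, ← hb, ht.mul_right_dvd, hs.dvd_mul_right] at this

/-- The non-units of a total quotient ring are zero-divisors. -/
theorem exists_mul_eq_zero_of_not_isUnit_localization {R : Type*} [CommRing R]
    (t : Localization (nonZeroDivisors R)) (ht : ¬ IsUnit t) : ∃ u, u ≠ 0 ∧ t * u = 0 := by
  by_contra! h
  obtain ⟨⟨a, s⟩, ha⟩ := IsLocalization.surj (nonZeroDivisors R) t
  have haR : a ∈ nonZeroDivisors R := by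
    rw [mem_nonZeroDivisors_iff_right]
    intro x hx
    by_contra hx0
    refine h (algebraMap R _ x) ((map_ne_zero_iff _
      (IsLocalization.injective _ (le_refl (nonZeroDivisors R)))).mpr hx0) ?_
    rw [← (IsLocalization.map_units (Localization (nonZeroDivisors R)) s).mul_left_eq_zero,
      mul_right_comm, ha, ← map_mul, mul_comm, hx, map_zero]
  refine ht (isUnit_of_mul_isUnit_left (ha ▸ ?_ : IsUnit (t * algebraMap R _ s.1)))
  exact IsLocalization.map_units (Localization (nonZeroDivisors R)) ⟨a, haR⟩

/-- A chain ring is semicoherent as soon as the annihilator of some nonzero `r` is nonzero and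
becomes principal in the total quotient ring. -/
theorem isSemicoherent_of_annihilator {R : Type u} [CommRing R] [PreValuationRing R]
    {r a : R} (hr : r ≠ 0) (ha : a ≠ 0) (hra : r * a = 0)
    (h : ∀ x, r * x = 0 → ∃ c ∈ nonZeroDivisors R, a ∣ c * x) : IsSemicoherent R := by
  let Q := Localization (nonZeroDivisors R)
  have hinj : Function.Injective (algebraMap R Q) :=
    IsLocalization.injective Q le_rfl
  have : PreValuationRing Q := preValuationRing_localization _
  refine isSemicoherent_of_isIFRing_localization (isIFRing_of_annihilator
    exists_mul_eq_zero_of_not_isUnit_localization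
    (exists_annihilator_eq_of_exists (r := algebraMap R Q r) (a := algebraMap R Q a)
      ((map_ne_zero_iff _ hinj).mpr hr) ((map_ne_zero_iff _ hinj).mpr ha)
      fun x => ⟨fun hx => ?_, ?_⟩))
  · obtain ⟨⟨b, s⟩, hb⟩ := IsLocalization.surj (nonZeroDivisors R) x
    obtain ⟨c, hc, hac⟩ := h b (hinj (by
      rw [map_mul, ← hb, ← mul_assoc, hx, zero_mul, map_zero]))
    have := map_dvd (algebraMap R Q) hac
    rwa [map_mul, (IsLocalization.map_units Q ⟨c, hc⟩).dvd_mul_left, ← hb,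
      (IsLocalization.map_units Q s).dvd_mul_right] at this
  · rintro ⟨y, rfl⟩
    rw [← mul_assoc, ← map_mul, hra, map_zero, zero_mul]

/-- Integral domains are semicoherent. -/
theorem isSemicoherent_of_isDomain {R : Type u} [CommRing R] [IsDomain R] : IsSemicoherent R :=
  isSemicoherent_of_isIFRing_localization fun M _ _ _ =>
    inferInstanceAs (Module.Flat (FractionRing R) M)

/-- If `R` is a chain ring which is not semicoherent and `Z` is its
ideal of zero-divisors, then `w.d.(R/Z) = 1`. -/
theorem weakDim_quotient_zeroDivisors_eq_one (R : Type u) [CommRing R]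
    (hR : IsChainRing R) (hsc : ¬ IsSemicoherent R)
    (Z : Ideal R) (hZ : (Z : Set R) = zeroDivisorsSet R) :
    weakDim R (R ⧸ Z) = 1 := by
  have hmem (r : R) : r ∈ Z ↔ ∃ s, s ≠ 0 ∧ r * s = 0 := Set.ext_iff.mp hZ r
  have hone : (1 : R) ∉ Z := fun h => by
    obtain ⟨s, hs, hs'⟩ := (hmem 1).mp h
    exact hs (by simpa using hs')
  have hreg {c : R} (hc : c ∉ Z) : c ∈ nonZeroDivisors R := by
    rw [mem_nonZeroDivisors_iff_right]
    intro x hx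
    by_contra hx0
    exact hc ((hmem c).mpr ⟨x, hx0, by rw [mul_comm, hx]⟩)
  have : Nontrivial R := ⟨⟨1, 0, fun h => hone (h ▸ Z.zero_mem)⟩⟩
  have : PreValuationRing R := PreValuationRing.iff_ideal_total.mpr ⟨hR⟩
  have hflat : Module.Flat R Z := by
    refine flat_of_smul_eq_zero fun r a hra => ?_
    by_contra! hcon
    replace hra : r * (a : R) = 0 := congrArg Subtype.val hra
    have hr : r ≠ 0 := fun hr => hcon 1 a (by simp [hr]) (one_smul R a).symm
    have ha : (a : R) ≠ 0 := fun ha => hcon 0 0 (zero_mul r) (Subtype.ext (by simpa using ha))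
    refine hsc (isSemicoherent_of_annihilator hr ha hra fun x hx => ?_)
    obtain ⟨c, hc | hc⟩ := PreValuationRing.cond (a : R) x
    · exact ⟨1, one_mem _, c, by rw [one_mul, hc]⟩
    · refine ⟨c, hreg fun hcZ => ?_, 1, by rw [mul_one, ← hc, mul_comm]⟩
      exact hcon x ⟨c, hcZ⟩ (by rw [mul_comm, hx]) (Subtype.ext hc.symm)
  obtain ⟨r, hrZ, hr⟩ : ∃ r ∈ Z, r ≠ 0 := by
    by_contra! hcon
    have : NoZeroDivisors R := ⟨fun {a b} hab => by
      by_contra! hne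
      exact hne.1 (hcon a ((hmem a).mpr ⟨b, hne.2, hab⟩))⟩
    have : IsDomain R := NoZeroDivisors.to_isDomain R
    exact hsc isSemicoherent_of_isDomain
  refine le_antisymm (sInf_le ⟨1, rfl, isZero_Tor_two_quotient Z⟩) (le_sInf ?_)
  rintro _ ⟨k, rfl, hk⟩
  cases k with
  | zero =>
    obtain ⟨z, hz, hrz⟩ := exists_mul_eq_of_isZero_Tor_one Z hrZ (hk _)
    refine absurd ?_ hone
    have := Z.add_mem ((hmem (1 - z)).mpr ⟨r, hr, by rw [mul_comm, hrz]⟩) hz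
    rwa [sub_add_cancel] at this
  | succ k => exact_mod_cast Nat.succ_le_succ (Nat.zero_le k)
end

section
/- Let R be a chain ring with maximal ideal P, set of zero-divisors Z, and let H be the R-module defined by: H = E(R/rR) for a fixed 0 ≠ r ∈ P if R is an IF-ring, and H = E(R/Z)/Rx for a fixed x ∈ E(R/Z) with (0:x) = Z otherwise. Then for every injective R-module G there exists a pure exact sequence 0 → K → I → G → 0 in which I is a direct sum of submodules each isomorphic to R or to H. -/
open CategoryTheory

universe u

/-- The module `H` of the paper: if `R` is an IF-ring, `H = E(R/rR)` for some `0 ≠ r ∈ P`;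
if `R` is not an IF-ring, `H = E(R/Z)/Rx` for some `x ∈ E(R/Z)` with `(0 : x) = Z`,
where `Z` is the ideal of zero-divisors of `R`. -/
def IsHModule (R : Type u) [CommRing R] [IsLocalRing R] (Z : Ideal R)
    (H : Type u) [AddCommGroup H] [Module R H] : Prop :=
  (IsIFRing R ∧ ∃ r : R, r ≠ 0 ∧ r ∈ IsLocalRing.maximalIdeal R ∧
      ∃ i : (R ⧸ Ideal.span {r}) →ₗ[R] H, IsInjectiveHull R (R ⧸ Ideal.span {r}) H i) ∨
  (¬ IsIFRing R ∧ ∃ (E : Type u) (_ : AddCommGroup E) (_ : Module R E)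
      (i : (R ⧸ Z) →ₗ[R] E) (x : E), IsInjectiveHull R (R ⧸ Z) E i ∧
      Ideal.torsionOf R E x = Z ∧
      Nonempty ((E ⧸ Submodule.span R {x}) ≃ₗ[R] H))

theorem IsChainRing.dvd_total_s6 {R : Type u} [CommRing R] (hR : IsChainRing R) (a b : R) :
    a ∣ b ∨ b ∣ a := by
  simpa only [Ideal.span_singleton_le_span_singleton, or_comm] using
    hR (Ideal.span {a}) (Ideal.span {b})

theorem IsChainRing.exists_dvd_forall_mem {R : Type u} [CommRing R] (hR : IsChainRing R)
    {α : Type*} (a : α → R) {s : Finset α} (hs : s.Nonempty) :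
    ∃ p ∈ s, ∀ q ∈ s, a p ∣ a q := by
  induction hs using Finset.Nonempty.cons_induction with
  | singleton p => exact ⟨p, by simp⟩
  | cons p s hp hs ih =>
    obtain ⟨q, hq, hdvd⟩ := ih
    rcases hR.dvd_total_s6 (a p) (a q) with h | h
    · exact ⟨p, by simp, by simpa using fun i hi => h.trans (hdvd i hi)⟩
    · exact ⟨q, by simp [hq], by simpa using ⟨h, hdvd⟩⟩

section Purity

variable {R K M : Type u} [CommRing R] [AddCommGroup K] [Module R K] [AddCommGroup M] [Module R M]

/-- Over a chain ring, if single equations `k = s • y` with `k` in a submodule can be solved in the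
submodule as soon as they can be solved in the whole module, then so can finite linear systems. -/
theorem IsChainRing.exists_solution (hR : IsChainRing R) (f : K →ₗ[R] M)
    (hf : ∀ (s : R) (k : K) (y : M), f k = s • y → ∃ k', k = s • k')
    {ι κ : Type*} [Fintype κ] (s : Finset ι) (a : ι → κ → R) (k : ι → K) (y : κ → M)
    (h : ∀ i ∈ s, f (k i) = ∑ j, a i j • y j) :
    ∃ z : κ → K, ∀ i ∈ s, k i = ∑ j, a i j • z j := by
  classical
  induction hn : s.card generalizing s a k y with
  | zero =>
    obtain rfl := Finset.card_eq_zero.mp hn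
    exact ⟨0, by simp⟩
  | succ n ih =>
    have hs : s.Nonempty := Finset.card_pos.mp (by omega)
    rcases isEmpty_or_nonempty κ with hκ | hκ
    · refine ⟨0, fun i hi => ?_⟩
      obtain ⟨k', hk'⟩ := hf 0 (k i) 0 (by simp [h i hi])
      simp [hk']
    obtain ⟨⟨p, q⟩, hpq, hdvd⟩ := hR.exists_dvd_forall_mem (fun t : ι × κ => a t.1 t.2)
      (hs.product (Finset.univ_nonempty (α := κ)))
    simp only [Finset.mem_product, Finset.mem_univ, and_true, Prod.forall] at hpq hdvd
    choose! c hc using fun j => hdvd p j hpq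
    choose! d hd using fun i hi => hdvd i q hi
    obtain ⟨w, hw⟩ := hf (a p q) (k p) (∑ j, c j • y j) (by
      rw [h p hpq, Finset.smul_sum]
      exact Finset.sum_congr rfl fun j _ => by rw [smul_smul, ← hc])
    obtain ⟨z, hz⟩ := ih (s.erase p) (fun i j => a i j - d i * a p j) (fun i => k i - d i • k p) y
      (fun i hi => by
        simp only [map_sub, map_smul, h i (Finset.mem_of_mem_erase hi), h p hpq, sub_smul,
          Finset.sum_sub_distrib, Finset.smul_sum, smul_smul])
      (by rw [Finset.card_erase_of_mem hpq, hn]; rfl)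
    set v := w - ∑ j, c j • z j with hv
    have hsum (b : κ → R) : ∑ j, b j • (z j + if j = q then v else 0) =
        ∑ j, b j • z j + b q • v := by
      simp [smul_add, Finset.sum_add_distrib]
    have hkp : k p = ∑ j, a p j • z j + a p q • v := by
      have : ∑ j, a p j • z j = a p q • ∑ j, c j • z j := by
        rw [Finset.smul_sum]
        exact Finset.sum_congr rfl fun j _ => by rw [smul_smul, ← hc]
      rw [this, hw, hv, smul_sub]
      abel
    refine ⟨fun j => z j + if j = q then v else 0, fun i hi => ?_⟩
    rw [hsum]
    rcases eq_or_ne i p with rfl | hip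
    · exact hkp
    · have hi' := hz i (Finset.mem_erase.mpr ⟨hip, hi⟩)
      simp only [sub_smul, Finset.sum_sub_distrib, mul_smul, ← Finset.smul_sum] at hi'
      rw [sub_eq_iff_eq_add.mp hi', hkp, hd i hi, smul_add, smul_smul, mul_comm (a p q)]
      abel

open TensorProduct in
/-- Purity of `f : K → M` tested on a finitely generated module. -/
theorem IsChainRing.lTensor_injective_of_finite (hR : IsChainRing R) (f : K →ₗ[R] M)
    (hf : ∀ (s : R) (k : K) (y : M), f k = s • y → ∃ k', k = s • k')
    (T : Type u) [AddCommGroup T] [Module R T] [Module.Finite R T] :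
    Function.Injective (f.lTensor T) := by
  rw [injective_iff_map_eq_zero]
  intro x hx
  obtain ⟨l, t, k, rfl⟩ := TensorProduct.exists_sum_tmul_eq x
  obtain ⟨n, g, hg⟩ := Module.Finite.exists_fin (R := R) (M := T)
  let m : Fin l ⊕ Fin n → T := Sum.elim t g
  let k₀ : Fin l ⊕ Fin n → K := Sum.elim k 0
  have hx₀ : ∑ i, t i ⊗ₜ[R] k i = ∑ i, m i ⊗ₜ[R] k₀ i := by simp [m, k₀]
  have hm : Submodule.span R (Set.range m) = ⊤ := by
    simp [m, Set.Sum.elim_range, Submodule.span_union, hg]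
  rw [hx₀, map_sum] at hx
  obtain ⟨r, a, y, hy, ha⟩ := vanishesTrivially_of_sum_tmul_eq_zero R hm
    (n := fun i => f (k₀ i)) (by simpa using hx)
  obtain ⟨z, hz⟩ := hR.exists_solution f hf Finset.univ a k₀ y (fun i _ => hy i)
  rw [hx₀]
  exact sum_tmul_eq_zero_of_vanishesTrivially R ⟨r, a, z, fun i => hz i (Finset.mem_univ i), ha⟩

theorem IsChainRing.rTensor_injective (hR : IsChainRing R) (f : K →ₗ[R] M)
    (hf : ∀ (s : R) (k : K) (y : M), f k = s • y → ∃ k', k = s • k')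
    (T : Type u) [AddCommGroup T] [Module R T] :
    Function.Injective (f.rTensor T) := by
  rw [← LinearMap.lTensor_inj_iff_rTensor_inj, injective_iff_map_eq_zero]
  intro x hx
  obtain ⟨P, hP, t, rfl⟩ := TensorProduct.exists_of_fg x
  obtain ⟨Q, hPQ, hQ, ht⟩ := TensorProduct.eq_zero_of_fg_of_subtype_eq_zero hP
    (t := f.lTensor P t) (by
      rwa [← LinearMap.comp_apply, LinearMap.rTensor_comp_lTensor,
        ← LinearMap.lTensor_comp_rTensor])
  have : Module.Finite R Q := Module.Finite.iff_fg.mpr hQ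
  rw [← LinearMap.comp_apply, LinearMap.rTensor_comp_lTensor,
    ← LinearMap.lTensor_comp_rTensor, LinearMap.comp_apply] at ht
  have ht₀ := (injective_iff_map_eq_zero _).mp
    (hR.lTensor_injective_of_finite f hf Q) _ ht
  rw [← Submodule.subtype_comp_inclusion P Q hPQ, LinearMap.rTensor_comp, LinearMap.comp_apply,
    ht₀, map_zero]

end Purity

theorem Module.Injective.exists_linearMap_apply_eq {R G M : Type u} [CommRing R]
    [AddCommGroup G] [Module R G] [AddCommGroup M] [Module R M] (hG : Module.Injective R G)
    (m : M) (y : G) (h : ∀ a : R, a • m = 0 → a • y = 0) : ∃ φ : M →ₗ[R] G, φ m = y := by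
  let f := LinearMap.toSpanSingleton R M m
  let g := LinearMap.toSpanSingleton R G y
  have hfg : f.ker ≤ g.ker := fun a ha => h a ha
  obtain ⟨φ, hφ⟩ := hG.out (f.ker.liftQ f le_rfl)
    (LinearMap.ker_eq_bot.mp (Submodule.ker_liftQ_eq_bot _ _ _ le_rfl)) (f.ker.liftQ g hfg)
  exact ⟨φ, by
    simpa only [Submodule.mkQ_apply, Submodule.liftQ_apply, LinearMap.toSpanSingleton_apply,
      one_smul, f, g] using hφ (f.ker.mkQ 1)⟩

section AnnihilatorOfElement

variable {R H : Type u} [CommRing R] [AddCommGroup H] [Module R H]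

theorem IsChainRing.exists_smul_eq_zero_iff_dvd_of_hull (hR : IsChainRing R) {r : R}
    (hr₀ : r ≠ 0) (hr : ¬ IsUnit r) {i : (R ⧸ Ideal.span {r}) →ₗ[R] H}
    (hi : IsInjectiveHull R (R ⧸ Ideal.span {r}) H i) {s : R} (hs : s ≠ 0) :
    ∃ h : H, ∀ a : R, a • h = 0 ↔ s ∣ a := by
  obtain ⟨hinj, hii, -⟩ := hi
  let u : H := i (Ideal.Quotient.mk _ 1)
  have hu (a : R) : a • u = 0 ↔ r ∣ a := by
    rw [← Ideal.mem_span_singleton, ← Ideal.Quotient.eq_zero_iff_mem, ← map_smul,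
      map_eq_zero_iff i hii, Algebra.smul_def, map_one, mul_one]
    rfl
  rcases hR.dvd_total_s6 r s with ⟨t, rfl⟩ | ⟨t, rfl⟩
  · obtain ⟨φ, hφ⟩ := hinj.exists_linearMap_apply_eq t u fun a ha => by
      rw [hu]
      refine (hR.dvd_total_s6 r a).resolve_right fun ⟨b, hb⟩ => hs ?_
      rw [hb, mul_right_comm, ← smul_eq_mul a t, ha, zero_mul]
    have hφ₁ (b : R) : (b * t) • φ 1 = b • u := by
      rw [← hφ, ← map_smul, ← map_smul]; simp
    refine ⟨φ 1, fun a => ⟨fun ha => ?_, ?_⟩⟩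
    · rcases hR.dvd_total_s6 t a with ⟨b, rfl⟩ | ⟨b, rfl⟩
      · rw [mul_comm, hφ₁, hu] at ha
        rw [mul_comm]
        exact mul_dvd_mul_left t ha
      · refine absurd ((hu 1).mp ?_) (mt isUnit_of_dvd_one hr)
        rw [← hφ₁, one_mul, mul_comm, mul_smul, ha, smul_zero]
    · rintro ⟨b, rfl⟩
      rw [mul_comm r t, mul_assoc, mul_comm, hφ₁, hu]
      exact dvd_mul_right r b
  · refine ⟨t • u, fun a => ?_⟩
    rw [smul_smul, hu]
    refine ⟨?_, fun h => mul_dvd_mul_right h t⟩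
    rintro ⟨b, hb⟩
    suffices s ∣ a - s * b by simpa using this.add (dvd_mul_right s b)
    refine (hR.dvd_total_s6 s (a - s * b)).resolve_right fun ⟨c, hc⟩ => hr₀ ?_
    calc s * t = (a * t - s * t * b) * c := by linear_combination t * hc
      _ = 0 := by rw [hb, sub_self, zero_mul]

theorem IsChainRing.exists_smul_eq_zero_iff_dvd_of_quotient [IsLocalRing R] (hR : IsChainRing R)
    {Z : Ideal R} (hZ : (Z : Set R) = zeroDivisorsSet R) {E : Type u} [AddCommGroup E] [Module R E]
    (hE : Module.Injective R E) {x : E} (hx : Ideal.torsionOf R E x = Z)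
    (e : (E ⧸ Submodule.span R {x}) ≃ₗ[R] H) {s : R} (hs : s ≠ 0) :
    ∃ h : H, ∀ a : R, a • h = 0 ↔ s ∣ a := by
  have hxa (a : R) : a • x = 0 ↔ ∃ t : R, t ≠ 0 ∧ a * t = 0 := by
    rw [← Ideal.mem_torsionOf_iff, hx, ← SetLike.mem_coe, hZ]
    rfl
  obtain ⟨φ, hφ⟩ := hE.exists_linearMap_apply_eq s x fun a ha => (hxa a).mpr ⟨s, hs, ha⟩
  replace hφ : s • φ 1 = x := by rw [← hφ, ← map_smul]; simp
  refine ⟨e (Submodule.Quotient.mk (φ 1)), fun a => ?_⟩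
  rw [← map_smul, e.map_eq_zero_iff, ← Submodule.Quotient.mk_smul, Submodule.Quotient.mk_eq_zero,
    Submodule.mem_span_singleton]
  constructor
  · rintro ⟨b, hb⟩
    rcases hR.dvd_total_s6 s a with h | ⟨c, rfl⟩
    · exact h
    have hcb : (1 - c * b) • x = 0 := by
      rw [sub_smul, one_smul, mul_smul, hb, smul_smul, mul_comm, hφ, sub_self]
    obtain ⟨t, ht, htz⟩ := (hxa _).mp hcb
    have hunit : IsUnit (c * b) :=
      (IsLocalRing.isUnit_or_isUnit_one_sub_self (c * b)).resolve_right fun h =>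
        ht (h.mul_right_eq_zero.mp htz)
    exact (isUnit_of_mul_isUnit_left hunit).mul_right_dvd.mpr dvd_rfl
  · rintro ⟨b, rfl⟩
    exact ⟨b, by rw [mul_comm, mul_smul, hφ]⟩

theorem IsHModule.exists_smul_eq_zero_iff_dvd [IsLocalRing R] (hR : IsChainRing R)
    {Z : Ideal R} (hZ : (Z : Set R) = zeroDivisorsSet R) (hH : IsHModule R Z H) {s : R}
    (hs : s ≠ 0) : ∃ h : H, ∀ a : R, a • h = 0 ↔ s ∣ a := by
  rcases hH with ⟨-, r, hr₀, hr, i, hi⟩ | ⟨-, E, _, _, i, x, hi, hx, ⟨e⟩⟩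
  · exact hR.exists_smul_eq_zero_iff_dvd_of_hull hr₀ ((IsLocalRing.mem_maximalIdeal r).mp hr) hi hs
  · exact hR.exists_smul_eq_zero_iff_dvd_of_quotient hZ hi.1 hx e hs

end AnnihilatorOfElement

/-- Over a chain ring, a map from a direct sum along which every solution of `s • y = 0` lifts
is a pure epimorphism. -/
theorem IsChainRing.exists_pure_exact_of_forall_exists {R : Type u} [CommRing R]
    (hR : IsChainRing R) {ι : Type u} {W : ι → Type u} [∀ i, AddCommGroup (W i)]
    [∀ i, Module R (W i)] {G : Type u} [AddCommGroup G] [Module R G] (φ : ∀ i, W i →ₗ[R] G)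
    (hφ : ∀ (s : R) (y : G), s • y = 0 → ∃ i, ∃ w : W i, s • w = 0 ∧ φ i w = y) :
    ∃ (K : Type u) (_ : AddCommGroup K) (_ : Module R K)
      (f : K →ₗ[R] DirectSum ι W) (g : DirectSum ι W →ₗ[R] G),
      Function.Injective f ∧ Function.Surjective g ∧ Function.Exact f g ∧
      ∀ (T : Type u) [AddCommGroup T] [Module R T],
        Function.Injective (LinearMap.rTensor T f) := by
  classical
  let g := DirectSum.toModule R ι G φ
  have hg (s : R) (y : G) (hy : s • y = 0) : ∃ w, s • w = 0 ∧ g w = y := by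
    obtain ⟨i, w, hw, rfl⟩ := hφ s y hy
    exact ⟨DirectSum.lof R ι W i w, by rw [← map_smul, hw, map_zero],
      DirectSum.toModule_lof R i w⟩
  refine ⟨g.ker, inferInstance, inferInstance, g.ker.subtype, g, g.ker.injective_subtype,
    fun y => ?_, g.exact_subtype_ker_map, fun T _ _ =>
      hR.rTensor_injective _ (fun s k y hk => ?_) T⟩
  · obtain ⟨w, -, hw⟩ := hg 0 y (zero_smul R y)
    exact ⟨w, hw⟩
  · obtain ⟨w, hw, hwy⟩ := hg s (g y) (by rw [← map_smul, ← hk]; exact k.2)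
    refine ⟨⟨y - w, by simp [hwy]⟩, Subtype.ext ?_⟩
    simpa [smul_sub, hw] using hk

/-- Over a chain ring `R`, every injective module `G` fits in a pure
exact sequence `0 → K → I → G → 0` where `I` is a direct sum of submodules each
isomorphic to `R` or to `H`. -/
theorem exists_pure_exact_of_injective (R : Type u) [CommRing R] [IsLocalRing R]
    (hR : IsChainRing R)
    (Z : Ideal R) (hZ : (Z : Set R) = zeroDivisorsSet R)
    (H : Type u) [AddCommGroup H] [Module R H] (hH : IsHModule R Z H)
    (G : Type u) [AddCommGroup G] [Module R G] (hG : Module.Injective R G) :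
    ∃ (ι : Type u) (W : ι → Type u) (_ : ∀ i, AddCommGroup (W i))
      (_ : ∀ i, Module R (W i)),
      (∀ i, Nonempty (W i ≃ₗ[R] R) ∨ Nonempty (W i ≃ₗ[R] H)) ∧
      ∃ (K : Type u) (_ : AddCommGroup K) (_ : Module R K)
        (f : K →ₗ[R] DirectSum ι W) (g : DirectSum ι W →ₗ[R] G),
        Function.Injective f ∧ Function.Surjective g ∧ Function.Exact f g ∧
        ∀ (T : Type u) [AddCommGroup T] [Module R T],
          Function.Injective (LinearMap.rTensor T f) := by
  refine ⟨G ⊕ (H →ₗ[R] G), Sum.elim (fun _ => R) (fun _ => H),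
    Sum.rec (fun _ => inferInstanceAs (AddCommGroup R)) (fun _ => inferInstanceAs (AddCommGroup H)),
    Sum.rec (fun _ => inferInstanceAs (Module R R)) (fun _ => inferInstanceAs (Module R H)),
    ?_, ?_⟩
  · rintro (_ | _)
    · exact Or.inl ⟨LinearEquiv.refl R R⟩
    · exact Or.inr ⟨LinearEquiv.refl R H⟩
  let _ (i : G ⊕ (H →ₗ[R] G)) :
      AddCommGroup (Sum.elim (fun _ => R) (fun _ => H) i) :=
    Sum.rec (fun _ => inferInstanceAs (AddCommGroup R)) (fun _ => inferInstanceAs (AddCommGroup H)) i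
  let _ (i : G ⊕ (H →ₗ[R] G)) : Module R (Sum.elim (fun _ => R) (fun _ => H) i) :=
    Sum.rec (fun _ => inferInstanceAs (Module R R)) (fun _ => inferInstanceAs (Module R H)) i
  let φ : ∀ i : G ⊕ (H →ₗ[R] G), Sum.elim (fun _ => R) (fun _ => H) i →ₗ[R] G :=
    Sum.rec (fun y => LinearMap.toSpanSingleton R G y) (fun ψ => ψ)
  refine hR.exists_pure_exact_of_forall_exists φ fun s y hy => ?_
  rcases eq_or_ne s 0 with rfl | hs
  · exact ⟨Sum.inl y, (1 : R), zero_smul R (1 : R), one_smul R y⟩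
  · obtain ⟨h, hh⟩ := hH.exists_smul_eq_zero_iff_dvd hR hZ hs
    obtain ⟨ψ, hψ⟩ := hG.exists_linearMap_apply_eq h y fun a ha => by
      obtain ⟨b, rfl⟩ := (hh a).mp ha
      rw [mul_comm, mul_smul, hy, smul_zero]
    exact ⟨Sum.inr ψ, h, (hh s).mpr dvd_rfl, hψ⟩
end

section
/- Let G be an almost FP-injective module over a chain ring R. Then for any x ∈ G and a ∈ R such that the annihilator (0:a) is strictly contained in the annihilator (0:x), there exists y ∈ G with x = ay. -/
open CategoryTheory

universe u

open scoped TensorProduct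

/-- If `Ext¹(X, Y) = 0`, then every `1`-cocycle `P₁ ⟶ Y` on a projective resolution `P` of `X` is
a coboundary. -/
theorem CategoryTheory.ProjectiveResolution.exists_d_comp_eq_of_isZero_ext_one
    {R : Type u} [CommRing R] {X Y : ModuleCat.{u} R} (P : ProjectiveResolution X)
    (h : Limits.IsZero (((Ext R (ModuleCat.{u} R) 1).obj (Opposite.op X)).obj Y))
    (c : P.complex.X 1 ⟶ Y) (hc : P.complex.d 2 1 ≫ c = 0) :
    ∃ g : P.complex.X 0 ⟶ Y, P.complex.d 1 0 ≫ g = c := by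
  have hexact := h.of_iso (P.isoExt (R := R) 1 Y).symm
  rw [← HomologicalComplex.exactAt_iff_isZero_homology,
    HomologicalComplex.exactAt_iff' _ 0 1 2 (by simp) (by simp),
    ShortComplex.moduleCat_exact_iff] at hexact
  exact hexact c hc

/-- Linear maps from a finitely generated ideal to an FP-injective module extend to the ring. -/
theorem IsFPInjective.exists_eq_smul {R : Type u} [CommRing R] {E : Type u} [AddCommGroup E]
    [Module R E] (hE : IsFPInjective R E) {I : Ideal R} (hI : I.FG) (f : I →ₗ[R] E) :
    ∃ y : E, ∀ a : I, f a = (a : R) • y := by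
  let X : ModuleCat.{u} R := ModuleCat.of R (R ⧸ I)
  have hX : Module.FinitePresentation R X :=
    Module.finitePresentation_of_surjective I.mkQ I.mkQ_surjective (by rwa [Submodule.ker_mkQ])
  let P : ProjectiveResolution X := ProjectiveResolution.of X
  let π : P.complex.X 0 →ₗ[R] R ⧸ I := (P.π.f 0).hom
  let d : P.complex.X 1 →ₗ[R] P.complex.X 0 := (P.complex.d 1 0).hom
  have hπd (w) : π (d w) = 0 :=
    LinearMap.congr_fun (congr_arg ModuleCat.Hom.hom (P.complex_d_comp_π_f_zero)) w
  have hπ : Function.Surjective π := (ModuleCat.epi_iff_surjective (P.π.f 0)).1 inferInstance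
  have hker (z) (hz : π z = 0) : ∃ w, d w = z :=
    (ShortComplex.moduleCat_exact_iff _).1 P.exact₀ z hz
  have : Module.Projective R (P.complex.X 0) :=
    (IsProjective.iff_projective _).2 (P.projective 0)
  obtain ⟨φ, hφ⟩ := Module.projective_lifting_property I.mkQ π I.mkQ_surjective
  replace hφ (z) : I.mkQ (φ z) = π z := LinearMap.congr_fun hφ z
  let φ₁ : P.complex.X 1 →ₗ[R] I := (φ ∘ₗ d).codRestrict I fun w ↦ by
    rw [← Submodule.ker_mkQ I, LinearMap.mem_ker, LinearMap.comp_apply, hφ, hπd]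
  obtain ⟨g, hg⟩ := P.exists_d_comp_eq_of_isZero_ext_one (hE X hX)
    (ModuleCat.ofHom (f ∘ₗ φ₁)) (by
      ext w
      have hw : φ₁ ((P.complex.d 2 1).hom w) = 0 := by
        ext
        have hdd : d ((P.complex.d 2 1).hom w) = 0 :=
          LinearMap.congr_fun (congr_arg ModuleCat.Hom.hom (P.complex.d_comp_d 2 1 0)) w
        simp [φ₁, hdd]
      exact (congr_arg f hw).trans f.map_zero)
  replace hg (w) : g.hom (d w) = f (φ₁ w) := LinearMap.congr_fun (congr_arg ModuleCat.Hom.hom hg) w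
  obtain ⟨p, hp⟩ := hπ (I.mkQ 1)
  have hk : φ p - 1 ∈ I := by
    rw [← Submodule.ker_mkQ I, LinearMap.mem_ker, map_sub, hφ, hp, sub_self]
  refine ⟨g.hom p - f ⟨φ p - 1, hk⟩, fun a ↦ ?_⟩
  obtain ⟨w, hw⟩ := hker ((a : R) • p) (by
    rw [map_smul, hp, ← map_smul, ← LinearMap.mem_ker, Submodule.ker_mkQ]
    simp)
  rw [smul_sub, ← map_smul, ← map_smul, ← hw, hg, ← map_sub]
  congr 1
  ext
  simp [φ₁, hw]
  ring

/-- An element of an FP-injective module killed by the annihilator of `a` is a multiple of `a`. -/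
theorem IsFPInjective.exists_smul_eq_of_torsionOf_le {R : Type u} [CommRing R] {E : Type u}
    [AddCommGroup E] [Module R E] (hE : IsFPInjective R E) {a : R} {e : E}
    (h : Ideal.torsionOf R R a ≤ Ideal.torsionOf R E e) : ∃ y : E, e = a • y := by
  let f : (Submodule.span R {a} : Ideal R) →ₗ[R] E :=
    (Ideal.torsionOf R R a).liftQ (LinearMap.toSpanSingleton R E e) h ∘ₗ
      (Ideal.quotTorsionOfEquivSpanSingleton R R a).symm
  obtain ⟨y, hy⟩ := hE.exists_eq_smul (Submodule.fg_span_singleton a) f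
  refine ⟨y, ?_⟩
  rw [← hy ⟨a, Submodule.mem_span_singleton_self a⟩]
  have ha : (Ideal.quotTorsionOfEquivSpanSingleton R R a).symm
      ⟨a, Submodule.mem_span_singleton_self a⟩ = Submodule.Quotient.mk 1 := by
    rw [LinearEquiv.symm_apply_eq, Ideal.quotTorsionOfEquivSpanSingleton_apply_mk, one_smul]
  have hfa : f ⟨a, Submodule.mem_span_singleton_self a⟩ = (1 : R) • e :=
    congr_arg ((Ideal.torsionOf R R a).liftQ (LinearMap.toSpanSingleton R E e) h) ha
  rw [hfa, one_smul]

/-- Purity implies relative divisibility: `D ∩ bE = bD` for a pure submodule `D` of `E`. -/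
theorem IsPureSubmodule.exists_smul_eq {R : Type u} [CommRing R] {E : Type u} [AddCommGroup E]
    [Module R E] {D : Submodule R E} (hD : IsPureSubmodule D) {b : R} {e : E} (he : b • e ∈ D) :
    ∃ d ∈ D, b • d = b • e := by
  let I : Ideal R := Ideal.span {b}
  have htmul : (⟨b • e, he⟩ : D) ⊗ₜ[R] (1 : R ⧸ I) = 0 := by
    apply hD (R ⧸ I)
    have hb : b • (1 : R ⧸ I) = 0 := by
      rw [Algebra.smul_def, mul_one]
      exact Ideal.Quotient.eq_zero_iff_mem.2 (Ideal.mem_span_singleton_self b)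
    simp [TensorProduct.smul_tmul, hb]
  have hmem : (⟨b • e, he⟩ : D) ∈ I • (⊤ : Submodule R D) := by
    rw [← Submodule.Quotient.mk_eq_zero, ← one_smul R (⟨b • e, he⟩ : D),
      ← TensorProduct.tensorQuotEquivQuotSMul_tmul_mk, map_one, htmul, map_zero]
  rw [Submodule.ideal_span_singleton_smul, Submodule.mem_smul_pointwise_iff_exists] at hmem
  obtain ⟨d, -, hd⟩ := hmem
  exact ⟨d, d.2, congr_arg Subtype.val hd⟩

/-- Let `G` be an almost FP-injective module over a chain ring `R`.
If `(0 : a) ⊊ (0 : x)` for `x ∈ G` and `a ∈ R`, then `x = a • y` for some `y ∈ G`. -/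
theorem exists_smul_eq_of_torsionOf_lt (R : Type u) [CommRing R] (hR : IsChainRing R)
    (G : Type u) [AddCommGroup G] [Module R G] (hG : IsAlmostFPInjective R G)
    (x : G) (a : R) (hlt : Ideal.torsionOf R R a < Ideal.torsionOf R G x) :
    ∃ y : G, x = a • y := by
  obtain ⟨E, _, _, D, hE, hD, ⟨φ⟩⟩ := hG
  obtain ⟨b, hbx, hba⟩ := SetLike.exists_of_lt hlt
  obtain ⟨e, he⟩ := D.mkQ_surjective (φ.symm x)
  have hbe : b • e ∈ D := by
    rw [← D.ker_mkQ, LinearMap.mem_ker, map_smul, he, ← map_smul,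
      (Ideal.mem_torsionOf_iff _ _).1 hbx, map_zero]
  obtain ⟨d, hdD, hd⟩ := hD.exists_smul_eq hbe
  have hle : Ideal.torsionOf R R a ≤ Ideal.span {b} :=
    (hR _ _).resolve_right fun h ↦ hba (h (Ideal.mem_span_singleton_self b))
  obtain ⟨y, hy⟩ := hE.exists_smul_eq_of_torsionOf_le (a := a) (e := e - d)
    (hle.trans <| by
      rw [Ideal.span_singleton_le_iff_mem, Ideal.mem_torsionOf_iff, smul_sub, hd, sub_self])
  refine ⟨φ (D.mkQ y), ?_⟩
  have hd0 : D.mkQ d = 0 := by rwa [← LinearMap.mem_ker, D.ker_mkQ]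
  rw [← map_smul, ← map_smul, ← hy, map_sub, hd0, sub_zero, he, φ.apply_symm_apply]
end
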